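/- arXiv:math/0501063 — 2 statements merged into one kernel-verified Lean document; each statement's English description precedes it below -/
import Mathlib

section
/- Let (R, m) be a commutative Noetherian local ring, M a finitely generated R-module of dimension n, and a ⊆ b proper ideals of R. Then there exists a surjective R-module homomorphism H_b^n(M) → H_a^n(M). -/
noncomputable section

universe u

open CategoryTheory

/-- The `i`-th local cohomology of a module with respect to an ideal. -/
abbrev LC {R : Type u} [CommRing R] (J : Ideal R) (i : ℕ) (M : Type u)
    [AddCommGroup M] [Module R M] : ModuleCat.{u} R :=
  (localCohomology J i).obj (ModuleCat.of R M)

/-- Attached primes of a module: primes of the form `Ann(T/U)`. -/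
def Att (R : Type u) [CommRing R] (T : Type u) [AddCommGroup T] [Module R T] :
    Set (Ideal R) :=
  { p | p.IsPrime ∧ ∃ U : Submodule R T, p = Module.annihilator R (T ⧸ U) }

/-- Krull dimension of a module, as the Krull dimension of its support. -/
def mdim (R : Type u) [CommRing R] (M : Type u) [AddCommGroup M] [Module R M] :
    WithBot ℕ∞ :=
  Order.krullDim (Module.support R M)

/-- Cohomological dimension of `M` with respect to `J`:
the supremum of the `i` with `H_J^i(M) ≠ 0` (`⊥` if there are none). -/
def cohDim (R : Type u) [CommRing R] (J : Ideal R) (M : Type u)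
    [AddCommGroup M] [Module R M] : WithBot ℕ∞ :=
  sSup { x | ∃ i : ℕ, x = (i : ℕ∞) ∧ Nontrivial (LC J i M) }


namespace LCaux

variable {R : Type u} [CommRing R]

/-- Restriction of an extension class along a morphism. -/
noncomputable abbrev res {X X' Y : ModuleCat.{u} R} {n : ℕ} (g : X ⟶ X')
    (ξ : Abelian.Ext X' Y n) : Abelian.Ext X Y n :=
  (Abelian.Ext.mk₀ g).comp ξ (zero_add n)

/-- The projection `R/I → R/J`. -/
def qm {I J : Ideal R} (h : I ≤ J) : ModuleCat.of R (R ⧸ I) ⟶ ModuleCat.of R (R ⧸ J) :=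
  ModuleCat.ofHom (Submodule.mapQ _ _ LinearMap.id h)

lemma qm_comp {I J K : Ideal R} (h : I ≤ J) (h' : J ≤ K) :
    qm h ≫ qm h' = qm (h.trans h') := by
  ext
  rfl

lemma res_res {X X' X'' Y : ModuleCat.{u} R} {n : ℕ} (g : X ⟶ X') (g' : X' ⟶ X'')
    (ξ : Abelian.Ext X'' Y n) : res g (res g' ξ) = res (g ≫ g') ξ :=
  Abelian.Ext.mk₀_comp_mk₀_assoc _ _ _

lemma res_qm_qm {I J K : Ideal R} {Y : ModuleCat.{u} R} {n : ℕ} (h : I ≤ J) (h' : J ≤ K)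
    (ξ : Abelian.Ext (ModuleCat.of R (R ⧸ K)) Y n) :
    res (qm h) (res (qm h') ξ) = res (qm (h.trans h')) ξ := by
  rw [res_res, qm_comp]

lemma res_comp {X X' Y Z : ModuleCat.{u} R} {n m k : ℕ} (g : X ⟶ X')
    (ξ : Abelian.Ext X' Y n) (η : Abelian.Ext Y Z m) (h : n + m = k) :
    res g (ξ.comp η h) = (res g ξ).comp η h := by
  unfold res
  rw [Abelian.Ext.comp_assoc]
  omega

/-- the short complex `ker p → F → N`. -/
def kerSC {F N : Type u} [AddCommGroup F] [Module R F] [AddCommGroup N] [Module R N]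
    (p : F →ₗ[R] N) : ShortComplex (ModuleCat.{u} R) :=
  ShortComplex.mk (ModuleCat.ofHom (LinearMap.ker p).subtype) (ModuleCat.ofHom p) (by
    ext x
    exact x.2)

lemma kerSC_shortExact {F N : Type u} [AddCommGroup F] [Module R F] [AddCommGroup N] [Module R N]
    (p : F →ₗ[R] N) (hp : Function.Surjective p) : (kerSC p).ShortExact where
  exact := by
    rw [ShortComplex.moduleCat_exact_iff]
    intro x hx
    exact ⟨⟨x, hx⟩, rfl⟩
  mono_f := (ModuleCat.mono_iff_injective _).2 (Subtype.val_injective)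
  epi_g := (ModuleCat.epi_iff_surjective _).2 hp

/-- map of kernel sequences -/
def kerSCmap {F N F' N' : Type u} [AddCommGroup F] [Module R F] [AddCommGroup N] [Module R N]
    [AddCommGroup F'] [Module R F'] [AddCommGroup N'] [Module R N']
    (p' : F' →ₗ[R] N') (p : F →ₗ[R] N) (f : F' →ₗ[R] F) (g : N' →ₗ[R] N)
    (k : LinearMap.ker p' →ₗ[R] LinearMap.ker p)
    (hk : ∀ x, (k x : F) = f x)
    (h : ∀ x, p (f x) = g (p' x)) : kerSC p' ⟶ kerSC p where
  τ₁ := ModuleCat.ofHom k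
  τ₂ := ModuleCat.ofHom f
  τ₃ := ModuleCat.ofHom g
  comm₁₂ := by
    ext x
    exact hk x
  comm₂₃ := by
    ext x
    exact h x

lemma exists_delta {F N : Type u} [AddCommGroup F] [Module R F] [AddCommGroup N]
    [Module R N] [Module.Projective R F]
    (p : F →ₗ[R] N) (hp : Function.Surjective p) (Y : ModuleCat.{u} R) (i : ℕ)
    (ξ : Abelian.Ext (ModuleCat.of R N) Y (i + 1)) :
    ∃ η : Abelian.Ext (ModuleCat.of R (LinearMap.ker p)) Y i,
      (kerSC_shortExact p hp).extClass.comp η (add_comm 1 i) = ξ := by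
  have : Projective (ModuleCat.of R F) := by
    rw [← IsProjective.iff_projective]; infer_instance
  exact Abelian.Ext.contravariant_sequence_exact₃ (kerSC_shortExact p hp) Y ξ
    (Abelian.Ext.eq_zero_of_projective (P := ModuleCat.of R F) _) (add_comm 1 i)

lemma res_delta {F N F' N' : Type u} [AddCommGroup F] [Module R F] [AddCommGroup N] [Module R N]
    [AddCommGroup F'] [Module R F'] [AddCommGroup N'] [Module R N']
    (p' : F' →ₗ[R] N') (hp' : Function.Surjective p')
    (p : F →ₗ[R] N) (hp : Function.Surjective p) (f : F' →ₗ[R] F) (g : N' →ₗ[R] N)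
    (k : LinearMap.ker p' →ₗ[R] LinearMap.ker p)
    (hk : ∀ x, (k x : F) = f x)
    (h : ∀ x, p (f x) = g (p' x)) (Y : ModuleCat.{u} R) (i : ℕ)
    (η : Abelian.Ext (ModuleCat.of R (LinearMap.ker p)) Y i)
    (hη : res (ModuleCat.ofHom k) η = 0) :
    res (ModuleCat.ofHom g) ((kerSC_shortExact p hp).extClass.comp η (add_comm 1 i)) = 0 := by
  have nat := ShortComplex.ShortExact.extClass_naturality (kerSC_shortExact p' hp')
    (kerSC_shortExact p hp) (kerSCmap p' p f g k hk h)
  have e1 : res (ModuleCat.ofHom g) ((kerSC_shortExact p hp).extClass.comp η (add_comm 1 i)) =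
    (res (ModuleCat.ofHom g) (kerSC_shortExact p hp).extClass).comp η (add_comm 1 i) :=
    res_comp (Y := (kerSC p).X₁) (X' := (kerSC p).X₃) _ _ _ _
  rw [e1]
  have e2 : res (ModuleCat.ofHom g) (kerSC_shortExact p hp).extClass = _ := nat.symm
  rw [e2]
  have e3 : (Abelian.Ext.mk₀ (kerSCmap p' p f g k hk h).τ₁).comp η (zero_add i) = 0 := hη
  refine (Abelian.Ext.comp_assoc_of_second_deg_zero (kerSC_shortExact p' hp').extClass
    (Abelian.Ext.mk₀ (kerSCmap p' p f g k hk h).τ₁) η (add_comm 1 i)).trans ?_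
  rw [e3, Abelian.Ext.comp_zero]
  rfl

lemma ext_sub_comp {X Y Z : ModuleCat.{u} R} {n m k : ℕ} (α β : Abelian.Ext X Y n)
    (γ : Abelian.Ext Y Z m) (h : n + m = k) :
    (α - β).comp γ h = α.comp γ h - β.comp γ h :=
  map_sub (γ.postcomp X h) α β

lemma ext_comp_sub {X Y Z : ModuleCat.{u} R} {n m k : ℕ} (γ : Abelian.Ext X Y n)
    (α β : Abelian.Ext Y Z m) (h : n + m = k) :
    γ.comp (α - β) h = γ.comp α h - γ.comp β h :=
  map_sub (γ.precomp Z h) α β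

lemma res_zero {X X' Y : ModuleCat.{u} R} {n : ℕ} (g : X ⟶ X') :
    res g (0 : Abelian.Ext X' Y n) = 0 := Abelian.Ext.comp_zero _ _ _ _ _

lemma res_ofHom_comp {A B C : Type u} [AddCommGroup A] [Module R A] [AddCommGroup B] [Module R B]
    [AddCommGroup C] [Module R C] (f : A →ₗ[R] B) (g : B →ₗ[R] C) {Y : ModuleCat.{u} R} {n : ℕ}
    (η : Abelian.Ext (ModuleCat.of R C) Y n) (h : res (ModuleCat.ofHom g) η = 0) :
    res (ModuleCat.ofHom (g ∘ₗ f)) η = 0 := by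
  rw [ModuleCat.ofHom_comp, ← res_res, h, res_zero]

variable [IsNoetherianRing R]

lemma dies_step (J : Ideal R) (M : Type u) [AddCommGroup M] [Module R M] (i : ℕ)
    (ih : ∀ (N : Type u) [AddCommGroup N] [Module R N] [Module.Finite R N]
      (ξ : Abelian.Ext (ModuleCat.of R N) (ModuleCat.of R M) i),
      ∃ s : ℕ, res (ModuleCat.ofHom (J ^ s • ⊤ : Submodule R N).subtype) ξ = 0)
    {N : Type u} [AddCommGroup N] [Module R N]
    (F : Type u) [AddCommGroup F] [Module R F] [Module.Finite R F] [Module.Projective R F]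
    (p : F →ₗ[R] N) (hp : Function.Surjective p)
    (ξ : Abelian.Ext (ModuleCat.of R N) (ModuleCat.of R M) (i + 1)) :
    ∃ s : ℕ, res (ModuleCat.ofHom (J ^ s • ⊤ : Submodule R N).subtype) ξ = 0 := by
  obtain ⟨η, rfl⟩ := exists_delta p hp _ i ξ
  obtain ⟨s0, hs0⟩ := ih (LinearMap.ker p) η
  obtain ⟨c, hc⟩ := Ideal.exists_pow_inf_eq_pow_smul J (LinearMap.ker p)
  refine ⟨s0 + c, ?_⟩
  set F' : Submodule R (F) := J ^ (s0 + c) • ⊤ with hF'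
  set N' : Submodule R N := J ^ (s0 + c) • ⊤ with hN'
  have hmap : F'.map p = N' := by
    rw [hF', hN', Submodule.map_smul'', Submodule.map_top, LinearMap.range_eq_top.2 hp]
  let p' : F' →ₗ[R] N' := p.restrict (fun x hx => by
    rw [← hmap]; exact Submodule.mem_map_of_mem hx)
  have hp' : Function.Surjective p' := by
    rintro ⟨y, hy⟩
    rw [← hmap] at hy
    obtain ⟨x, hx, rfl⟩ := hy
    exact ⟨⟨x, hx⟩, rfl⟩
  have key : ∀ x : LinearMap.ker p', ∃ hx : (x.1.1 : F) ∈ LinearMap.ker p,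
      (⟨x.1.1, hx⟩ : LinearMap.ker p) ∈ (J ^ s0 • ⊤ : Submodule R (LinearMap.ker p)) := by
    rintro ⟨⟨x, hxF⟩, hx⟩
    have hxp : x ∈ LinearMap.ker p := congrArg Subtype.val hx
    refine ⟨hxp, ?_⟩
    have h1 : x ∈ J ^ (s0 + c) • ⊤ ⊓ LinearMap.ker p := ⟨hxF, hxp⟩
    rw [hc (s0 + c) (by omega), Nat.add_sub_cancel] at h1
    have h2 : x ∈ J ^ s0 • LinearMap.ker p :=
      Submodule.smul_mono le_rfl inf_le_right h1
    have h3 : (J ^ s0 • ⊤ : Submodule R (LinearMap.ker p)).map (LinearMap.ker p).subtype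
        = J ^ s0 • LinearMap.ker p := by
      rw [Submodule.map_smul'', Submodule.map_top, Submodule.range_subtype]
    rw [← h3] at h2
    obtain ⟨z, hz, hzx⟩ := h2
    have : z = ⟨x, hxp⟩ := Subtype.ext hzx
    rwa [← this]
  let k1 : LinearMap.ker p' →ₗ[R] (J ^ s0 • ⊤ : Submodule R (LinearMap.ker p)) :=
    { toFun := fun x => ⟨⟨x.1.1, (key x).1⟩, (key x).2⟩
      map_add' := fun _ _ => rfl
      map_smul' := fun _ _ => rfl }
  have hz := res_ofHom_comp k1 (J ^ s0 • ⊤ : Submodule R (LinearMap.ker p)).subtype η hs0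
  exact res_delta p' hp' p hp F'.subtype N'.subtype
    ((J ^ s0 • ⊤ : Submodule R (LinearMap.ker p)).subtype ∘ₗ k1)
    (fun _ => rfl) (fun _ => rfl) _ _ η hz

lemma dies_on_pow (J : Ideal R) (M : Type u) [AddCommGroup M] [Module R M]
    (k : ℕ) (hk : ∀ r ∈ J ^ k, ∀ x : M, r • x = 0) (i : ℕ) :
    ∀ (N : Type u) [AddCommGroup N] [Module R N] [Module.Finite R N]
    (ξ : Abelian.Ext (ModuleCat.of R N) (ModuleCat.of R M) i),
    ∃ s : ℕ, res (ModuleCat.ofHom (J ^ s • ⊤ : Submodule R N).subtype) ξ = 0 := by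
  induction i with
  | zero =>
    intro N _ _ _ ξ
    refine ⟨k, ?_⟩
    obtain ⟨f, rfl⟩ := (Abelian.Ext.mk₀_bijective _ _).2 ξ
    unfold res
    rw [Abelian.Ext.mk₀_comp_mk₀, Abelian.Ext.mk₀_eq_zero_iff]
    ext ⟨x, hx⟩
    change f.hom x = 0
    induction hx using Submodule.smul_induction_on' with
    | smul r hr n hn =>
      rw [map_smul]
      exact hk r hr _
    | add x hx y hy h1 h2 => rw [map_add, h1, h2, add_zero]
  | succ i ih =>
    intro N _ _ _ ξ
    obtain ⟨m, p, hp⟩ := Module.Finite.exists_fin' R N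
    exact dies_step J M i ih (Fin m → R) p hp ξ

lemma torsion_vanish (J : Ideal R) (M : Type u) [AddCommGroup M] [Module R M]
    (k : ℕ) (hk : ∀ r ∈ J ^ k, ∀ x : M, r • x = 0) (i t : ℕ)
    (ξ : Abelian.Ext (ModuleCat.of R (R ⧸ J ^ t)) (ModuleCat.of R M) (i + 1)) :
    ∃ (s : ℕ) (h : t ≤ s), res (qm (Ideal.pow_le_pow_right h)) ξ = 0 := by
  obtain ⟨η, rfl⟩ := exists_delta (J ^ t).mkQ (Submodule.mkQ_surjective _) _ i ξ
  obtain ⟨s0, hs0⟩ := dies_on_pow J M k hk i _ η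
  refine ⟨s0 + t, by omega, ?_⟩
  have key : ∀ x : LinearMap.ker (J ^ (s0 + t)).mkQ, ∃ hx : (x.1 : R) ∈ LinearMap.ker (J ^ t).mkQ,
        (⟨x.1, hx⟩ : LinearMap.ker (J ^ t).mkQ) ∈
          (J ^ s0 • ⊤ : Submodule R (LinearMap.ker (J ^ t).mkQ)) := by
    rintro ⟨x, hx⟩
    rw [Submodule.ker_mkQ] at hx
    have hxp : x ∈ LinearMap.ker (J ^ t).mkQ := by
      rw [Submodule.ker_mkQ]
      exact Ideal.pow_le_pow_right (by omega) hx
    refine ⟨hxp, ?_⟩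
    have h3 : (J ^ s0 • ⊤ : Submodule R (LinearMap.ker (J ^ t).mkQ)).map
        (LinearMap.ker (J ^ t).mkQ).subtype = J ^ (s0 + t) := by
      rw [Submodule.map_smul'', Submodule.map_top, Submodule.range_subtype, Submodule.ker_mkQ,
        pow_add]
      rfl
    rw [← h3] at hx
    obtain ⟨z, hz, hzx⟩ := hx
    have : z = ⟨x, hxp⟩ := Subtype.ext hzx
    rwa [← this]
  let k1 : LinearMap.ker (J ^ (s0 + t)).mkQ →ₗ[R]
      (J ^ s0 • ⊤ : Submodule R (LinearMap.ker (J ^ t).mkQ)) :=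
    { toFun := fun x => ⟨⟨x.1, (key x).1⟩, (key x).2⟩
      map_add' := fun _ _ => rfl
      map_smul' := fun _ _ => rfl }
  refine res_delta (J ^ (s0 + t)).mkQ (Submodule.mkQ_surjective _) (J ^ t).mkQ
    (Submodule.mkQ_surjective _) LinearMap.id _ ((Submodule.subtype _) ∘ₗ k1)
      (fun _ => rfl) (fun _ => rfl) _ _ η ?_
  exact res_ofHom_comp _ _ _ hs0

/-- devissage -/
lemma exists_torsion (a : Ideal R) (M : Type u) [AddCommGroup M] [Module R M]
    [Module.Finite R M] :
    ∃ Γ : Submodule R M, (∃ k : ℕ, ∀ r ∈ a ^ k, ∀ x : Γ, r • x = 0) ∧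
      ∃ y ∈ a, IsSMulRegular (M ⧸ Γ) y := by
  let G : ℕ →o Submodule R M :=
    ⟨fun k => Submodule.torsionBySet R M (a ^ k : Ideal R), by
      intro i j hij x hx
      rw [Submodule.mem_torsionBySet_iff] at hx ⊢
      rintro ⟨r, hr⟩
      exact hx ⟨r, Ideal.pow_le_pow_right hij hr⟩⟩
  obtain ⟨k, hk⟩ := monotone_stabilizes_iff_noetherian.2 (inferInstance : IsNoetherian R M) G
  refine ⟨G k, ⟨k, ?_⟩, ?_⟩
  · rintro r hr ⟨x, hx⟩
    have := (Submodule.mem_torsionBySet_iff _ _).1 hx ⟨r, hr⟩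
    exact Subtype.ext this
  · have tf : ∀ x : M ⧸ G k, (∀ r ∈ a, r • x = 0) → x = 0 := by
      intro x hx
      obtain ⟨x, rfl⟩ := Submodule.mkQ_surjective _ x
      have h1 : ∀ r ∈ a, r • x ∈ G k := fun r hr => by
        have := hx r hr
        rw [← map_smul] at this
        exact (Submodule.Quotient.mk_eq_zero _).1 this
      have h2 : x ∈ G (k + 1) := by
        change x ∈ Submodule.torsionBySet R M _
        rw [Submodule.mem_torsionBySet_iff]
        rintro ⟨r, hr⟩
        change r • x = 0
        change r ∈ a ^ (k + 1) at hr
        rw [pow_succ] at hr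
        induction hr using Submodule.mul_induction_on' with
        | mem_mul_mem m hm n hn =>
          rw [mul_smul]
          exact (Submodule.mem_torsionBySet_iff _ _).1 (h1 n hn) ⟨m, hm⟩
        | add x hx y hy h1 h2 => rw [add_smul, h1, h2, add_zero]
      rw [← hk (k + 1) (by omega)] at h2
      simpa using h2
    by_contra hcon
    push Not at hcon
    have hsub : (a : Set R) ⊆ ⋃ p ∈ ((associatedPrimes.finite R (M ⧸ G k)).toFinset : Set (Ideal R)),
        (id p : Ideal R) := by
      intro y hy
      have : y ∈ ({ r : R | IsSMulRegular (M ⧸ G k) r }ᶜ : Set R) := hcon y hy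
      rw [← biUnion_associatedPrimes_eq_compl_regular] at this
      simpa using this
    rw [Ideal.subset_union_prime ⊥ ⊥] at hsub
    · obtain ⟨p, hp, hap⟩ := hsub
      rw [Set.Finite.mem_toFinset] at hp
      obtain ⟨hpp, x, hx⟩ := isAssociatedPrime_iff.1 hp
      have hx0 : x = 0 := tf x (fun r hr => by
        have h5 : r ∈ p := hap hr
        rw [hx, Submodule.mem_colon_singleton] at h5
        exact h5)
      apply hpp.ne_top
      rw [hx, hx0, Ideal.eq_top_iff_one, Submodule.mem_colon_singleton]
      simp
    · intro p hp _ _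
      rw [Set.Finite.mem_toFinset] at hp
      exact hp.1

lemma dim_quot {M : Type u} [AddCommGroup M] [Module R M] [Module.Finite R M] {y : R}
    (hy : IsSMulRegular M y) (t : ℕ) :
    Module.supportDim R (QuotSMulTop (y ^ t) M) + 1 ≤ Module.supportDim R M :=
  Module.supportDim_quotSMulTop_succ_le_of_notMem_minimalPrimes
    (fun _ ↦ (hy.pow t).notMem_of_mem_minimalPrimes)

/-- Every class on `R/a^t` comes from the connecting map for multiplication by `y^t`. -/
lemma exists_conn (a : Ideal R) {M : Type u} [AddCommGroup M] [Module R M] {y : R} (hya : y ∈ a)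
    (hy : IsSMulRegular M y) (t n : ℕ)
    (ξ : Abelian.Ext (ModuleCat.of R (R ⧸ a ^ t)) (ModuleCat.of R M) (n + 1)) :
    ∃ η : Abelian.Ext (ModuleCat.of R (R ⧸ a ^ t)) (ModuleCat.of R (QuotSMulTop (y ^ t) M)) n,
      η.comp (IsSMulRegular.smulShortComplex_shortExact (M := ModuleCat.of R M)
        (hy.pow t)).extClass rfl = ξ := by
  refine Abelian.Ext.covariant_sequence_exact₁ _ (IsSMulRegular.smulShortComplex_shortExact
    (M := ModuleCat.of R M) (hy.pow t)) ξ ?_ rfl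
  rw [ModuleCat.smulShortComplex_f_eq_smul_id]
  refine (Abelian.Ext.smul_eq_comp_mk₀ ξ (y ^ t)).symm.trans ?_
  rw [← Abelian.Ext.mk₀_id_comp ξ, ← Abelian.Ext.smul_comp, ← Abelian.Ext.mk₀_smul]
  have : (y ^ t • 𝟙 (ModuleCat.of R (R ⧸ a ^ t))) = 0 := by
    ext
    change y ^ t • (Submodule.Quotient.mk (1 : R) : R ⧸ a ^ t) = 0
    rw [← Submodule.Quotient.mk_smul, Submodule.Quotient.mk_eq_zero]
    simpa using Ideal.pow_mem_pow hya t
  rw [this, Abelian.Ext.mk₀_zero, Abelian.Ext.zero_comp]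
  rfl

/-- the short complex `Γ → M → M/Γ` -/
def subSC {M : Type u} [AddCommGroup M] [Module R M] (Γ : Submodule R M) :
    ShortComplex (ModuleCat.{u} R) :=
  ShortComplex.mk (ModuleCat.ofHom Γ.subtype) (ModuleCat.ofHom Γ.mkQ) (by
    ext x
    exact (Submodule.Quotient.mk_eq_zero _).2 x.2)

lemma subSC_shortExact {M : Type u} [AddCommGroup M] [Module R M] (Γ : Submodule R M) :
    (subSC Γ).ShortExact where
  exact := by
    rw [ShortComplex.moduleCat_exact_iff]
    intro x hx
    exact ⟨⟨x, (Submodule.Quotient.mk_eq_zero _).1 hx⟩, rfl⟩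
  mono_f := (ModuleCat.mono_iff_injective _).2 (Subtype.val_injective)
  epi_g := (ModuleCat.epi_iff_surjective _).2 (Submodule.mkQ_surjective _)

lemma grothendieck_vanish (J : Ideal R) (i : ℕ) :
    ∀ (M : Type u) [AddCommGroup M] [Module R M] [Module.Finite R M]
    (_ : Module.supportDim R M < i) (t : ℕ)
    (ξ : Abelian.Ext (ModuleCat.of R (R ⧸ J ^ t)) (ModuleCat.of R M) i),
    ∃ (s : ℕ) (h : t ≤ s), res (qm (Ideal.pow_le_pow_right h)) ξ = 0 := by
  induction i with
  | zero =>
    intro M _ _ _ hdim t ξ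
    have : Subsingleton M := by
      by_contra hM
      rw [not_subsingleton_iff_nontrivial] at hM
      have h1 := Module.supportDim_ne_bot_of_nontrivial R M
      obtain ⟨d, hd⟩ := WithBot.ne_bot_iff_exists.1 h1
      rw [← hd] at hdim
      have : d < 0 := by exact_mod_cast hdim
      simp at this
    refine ⟨t, le_rfl, ?_⟩
    obtain ⟨f, rfl⟩ := (Abelian.Ext.mk₀_bijective _ _).2 ξ
    have : f = 0 := by
      ext
      exact Subsingleton.elim (α := M) _ _
    rw [this, Abelian.Ext.mk₀_zero, res_zero]
  | succ i ih =>
    intro M _ _ _ hdim t ξ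
    obtain ⟨Γ, ⟨k, hk⟩, y, hya, hy⟩ := exists_torsion J M
    have hd : ∀ t, Module.supportDim R (QuotSMulTop (y ^ t) (M ⧸ Γ)) < i := by
      intro t
      have h1 := (dim_quot hy t).trans
        (Module.supportDim_le_of_surjective Γ.mkQ (Submodule.mkQ_surjective _))
      have h2 := h1.trans_lt hdim
      rw [Nat.cast_succ] at h2
      exact lt_of_add_lt_add_right h2
    let ξ' : Abelian.Ext (ModuleCat.of R (R ⧸ J ^ t)) (ModuleCat.of R (M ⧸ Γ)) (i + 1) :=
      ξ.comp (Abelian.Ext.mk₀ (ModuleCat.ofHom Γ.mkQ)) (add_zero _)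
    obtain ⟨η, hη⟩ := exists_conn J hya hy t i ξ'
    obtain ⟨s, hs, hηs⟩ := ih _ (hd t) t η
    have h3 : res (qm (Ideal.pow_le_pow_right hs)) ξ' = 0 := by
      rw [← hη]
      refine (res_comp _ _ _ _).trans ?_
      rw [hηs]
      exact Abelian.Ext.zero_comp ..
    have h4 : (res (qm (Ideal.pow_le_pow_right hs)) ξ).comp
      (Abelian.Ext.mk₀ (ModuleCat.ofHom Γ.mkQ)) (add_zero _) = 0 := by
      rw [← res_comp]
      exact h3
    obtain ⟨ζ, hζ⟩ := Abelian.Ext.covariant_sequence_exact₂ _ (subSC_shortExact Γ) _ h4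
    obtain ⟨s', hs', hζs⟩ := torsion_vanish J Γ k hk i s ζ
    refine ⟨s', hs.trans hs', ?_⟩
    rw [← res_qm_qm (Ideal.pow_le_pow_right hs') (Ideal.pow_le_pow_right hs), ← hζ]
    refine (res_comp _ _ _ _).trans ?_
    have : res (qm (Ideal.pow_le_pow_right hs')) ζ = 0 := hζs
    rw [this]
    exact Abelian.Ext.zero_comp ..

lemma dim_zero [IsLocalRing R] (b : Ideal R) (hb : b ≠ ⊤) (M : Type u) [AddCommGroup M]
    [Module R M] [Module.Finite R M] (hdim : Module.supportDim R M ≤ 0) :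
    ∃ k : ℕ, ∀ r ∈ b ^ k, ∀ x : M, r • x = 0 := by
  have h1 : b ≤ (Module.annihilator R M).radical := by
    rw [Ideal.radical_eq_sInf]
    refine le_sInf ?_
    rintro p ⟨hp, hpp⟩
    have hps : (⟨p, hpp⟩ : PrimeSpectrum R) ∈ Module.support R M := by
      rw [Module.support_eq_zeroLocus]
      exact hp
    have hms : (⟨IsLocalRing.maximalIdeal R, inferInstance⟩ : PrimeSpectrum R)
        ∈ Module.support R M := Module.mem_support_mono (IsLocalRing.le_maximalIdeal hpp.ne_top) hps
    have hmax := Order.krullDim_nonpos_iff_forall_isMax.1 hdim ⟨⟨p, hpp⟩, hps⟩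
    have : IsLocalRing.maximalIdeal R ≤ p :=
      hmax (b := ⟨⟨IsLocalRing.maximalIdeal R, inferInstance⟩, hms⟩)
        (IsLocalRing.le_maximalIdeal hpp.ne_top)
    exact (IsLocalRing.le_maximalIdeal hb).trans this
  obtain ⟨k, hk⟩ := Ideal.exists_pow_le_of_le_radical_of_fg h1 (IsNoetherian.noetherian b)
  exact ⟨k, fun r hr x => Module.mem_annihilator.1 (hk hr) x⟩

lemma main_stage [IsLocalRing R] (a b : Ideal R) (hb : b ≠ ⊤) (hab : a ≤ b) (n : ℕ) :
    ∀ (M : Type u) [AddCommGroup M] [Module R M] [Module.Finite R M]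
    (_ : Module.supportDim R M ≤ n) (t : ℕ)
    (ξ : Abelian.Ext (ModuleCat.of R (R ⧸ a ^ t)) (ModuleCat.of R M) n),
    ∃ (s : ℕ) (h : t ≤ s)
      (ζ : Abelian.Ext (ModuleCat.of R (R ⧸ b ^ s)) (ModuleCat.of R M) n),
      res (qm (Ideal.pow_le_pow_right h)) ξ = res (qm (Ideal.pow_right_mono hab s)) ζ := by
  induction n with
  | zero =>
    intro M _ _ _ hdim t ξ
    obtain ⟨k, hk⟩ := dim_zero b hb M hdim
    obtain ⟨f, rfl⟩ := (Abelian.Ext.mk₀_bijective _ _).2 ξ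
    have hle : b ^ (t + k) ≤ LinearMap.ker (LinearMap.toSpanSingleton R M
        (f.hom (Submodule.Quotient.mk (1 : R)))) := by
      intro r hr
      rw [LinearMap.mem_ker, LinearMap.toSpanSingleton_apply]
      exact hk r (Ideal.pow_le_pow_right (by omega) hr) _
    let g : ModuleCat.of R (R ⧸ b ^ (t + k)) ⟶ ModuleCat.of R M :=
      ModuleCat.ofHom (Submodule.liftQ _ _ hle)
    refine ⟨t + k, by omega, Abelian.Ext.mk₀ g, ?_⟩
    unfold res
    rw [Abelian.Ext.mk₀_comp_mk₀, Abelian.Ext.mk₀_comp_mk₀]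
    congr 1
    ext
    change f.hom (Submodule.Quotient.mk (1 : R)) = (1 : R) • f.hom (Submodule.Quotient.mk (1 : R))
    rw [one_smul]
  | succ n ih =>
    intro M _ _ _ hdim t ξ
    obtain ⟨Γ, ⟨k, hk⟩, y, hya, hy⟩ := exists_torsion a M
    have hd : ∀ t, Module.supportDim R (QuotSMulTop (y ^ t) (M ⧸ Γ)) ≤ n := by
      intro t
      have h1 := (dim_quot hy t).trans
        (Module.supportDim_le_of_surjective Γ.mkQ (Submodule.mkQ_surjective _))
      have h2 := h1.trans hdim
      by_contra hcon
      rw [not_le] at hcon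
      have h3 := ENat.WithBot.add_one_le_iff.2 hcon
      have h4 := (add_le_add_left h3 1).trans h2
      have h5 : n + 1 + 1 ≤ n + 1 := by exact_mod_cast h4
      omega
    let π : ModuleCat.of R M ⟶ ModuleCat.of R (M ⧸ Γ) := ModuleCat.ofHom Γ.mkQ
    let ξ' : Abelian.Ext (ModuleCat.of R (R ⧸ a ^ t)) (ModuleCat.of R (M ⧸ Γ)) (n + 1) :=
      ξ.comp (Abelian.Ext.mk₀ π) (add_zero _)
    obtain ⟨η, hη⟩ := exists_conn a hya hy t n ξ'
    obtain ⟨s, hs, θ, hηs⟩ := ih _ (hd t) t η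
    -- the class on `M/Γ`
    let ζ : Abelian.Ext (ModuleCat.of R (R ⧸ b ^ s)) (ModuleCat.of R (M ⧸ Γ)) (n + 1) :=
      θ.comp (IsSMulRegular.smulShortComplex_shortExact (M := ModuleCat.of R (M ⧸ Γ))
        (hy.pow t)).extClass rfl
    have h3 : res (qm (Ideal.pow_le_pow_right hs)) ξ' = res (qm (Ideal.pow_right_mono hab s)) ζ := by
      rw [← hη]
      refine (res_comp _ _ _ _).trans ?_
      rw [hηs]
      exact (res_comp _ _ _ _).symm
    have hdΓ : Module.supportDim R Γ < ((n + 1 + 1 : ℕ) : WithBot ℕ∞) := by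
      refine ((Module.supportDim_le_of_injective Γ.subtype Subtype.val_injective).trans
        hdim).trans_lt ?_
      exact_mod_cast Nat.lt_succ_self (n + 1)
    obtain ⟨s', hs', hδ⟩ := grothendieck_vanish b (n + 1 + 1) Γ hdΓ s
      (ζ.comp (subSC_shortExact Γ).extClass rfl)
    have h4 : (res (qm (Ideal.pow_le_pow_right hs')) ζ).comp (subSC_shortExact Γ).extClass rfl
        = 0 := by
      exact (res_comp (X' := ModuleCat.of R (R ⧸ b ^ s)) (Y := (subSC Γ).X₃) _ ζ _ _).symm.trans hδ
    obtain ⟨ζ', hζ'⟩ := Abelian.Ext.covariant_sequence_exact₃ _ (subSC_shortExact Γ) _ _ h4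
    change Abelian.Ext (ModuleCat.of R (R ⧸ b ^ s')) (ModuleCat.of R M) (n + 1) at ζ'
    have hζ'' : ζ'.comp (Abelian.Ext.mk₀ π) (add_zero _) =
      res (qm (Ideal.pow_le_pow_right hs')) ζ := hζ'
    have h5 : (res (qm (Ideal.pow_le_pow_right (hs.trans hs'))) ξ -
        res (qm (Ideal.pow_right_mono hab s')) ζ').comp (Abelian.Ext.mk₀ π) (add_zero _) = 0 := by
      rw [ext_sub_comp, ← res_comp, ← res_comp, hζ'', res_qm_qm, sub_eq_zero]
      have h6 := congrArg (res (qm (Ideal.pow_le_pow_right (I := a) hs'))) h3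
      rw [res_qm_qm, res_qm_qm] at h6
      exact h6
    obtain ⟨ω, hω⟩ := Abelian.Ext.covariant_sequence_exact₂ _ (subSC_shortExact Γ) _ h5
    obtain ⟨s'', hs'', hωs⟩ := torsion_vanish a Γ k hk n s' ω
    refine ⟨s'', (hs.trans hs').trans hs'', res (qm (Ideal.pow_le_pow_right hs'')) ζ', ?_⟩
    have h7 : res (qm (Ideal.pow_le_pow_right hs''))
      (res (qm (Ideal.pow_le_pow_right (hs.trans hs'))) ξ -
        res (qm (Ideal.pow_right_mono hab s')) ζ') = 0 := by
      rw [← hω]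
      refine (res_comp _ _ _ _).trans ?_
      have : res (qm (Ideal.pow_le_pow_right hs'')) ω = 0 := hωs
      rw [this]
      exact Abelian.Ext.zero_comp ..
    unfold res at h7
    rw [ext_comp_sub, sub_eq_zero] at h7
    have h8 := (res_qm_qm _ _ _).symm.trans (h7.trans (res_qm_qm _ _ _))
    rw [res_qm_qm]
    exact h8

end LCaux
namespace LCaux

section OldExt
open Opposite

variable {R : Type u} [CommRing R]

lemma unop_comp_apply {A B C : (ModuleCat.{u} R)ᵒᵖ} (f : A ⟶ B) (g : B ⟶ C) (x : C.unop) :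
    f.unop.hom (g.unop.hom x) = (f ≫ g).unop.hom x := rfl

/-- `x` is a cocycle representing the class `c`. -/
def Rel (K : ChainComplex (ModuleCat.{u} R)ᵒᵖ ℕ) (n : ℕ) (x : (K.X n).unop)
    (c : (K.homology n).unop) : Prop :=
  ∃ z : (K.opcycles n).unop, (K.pOpcycles n).unop.hom z = x ∧ (K.homologyι n).unop.hom z = c

lemma Rel_surj (K : ChainComplex (ModuleCat.{u} R)ᵒᵖ ℕ) (n : ℕ) (c : (K.homology n).unop) :
    ∃ x, Rel K n x c ∧ (K.d (n + 1) n).unop.hom x = 0 := by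
  have : Epi (K.homologyι n).unop := inferInstance
  obtain ⟨z, hz⟩ := (ModuleCat.epi_iff_surjective _).1 this c
  refine ⟨_, ⟨z, rfl, hz⟩, ?_⟩
  rw [unop_comp_apply, HomologicalComplex.d_pOpcycles]
  rfl

lemma Rel_exists (K : ChainComplex (ModuleCat.{u} R)ᵒᵖ ℕ) (n : ℕ) (x : (K.X n).unop)
    (hx : (K.d (n + 1) n).unop.hom x = 0) : ∃ c, Rel K n x c := by
  have hex : (ShortComplex.mk _ _ (K.d_pOpcycles (n + 1) n)).Exact :=
    ShortComplex.exact_of_g_is_cokernel _ (K.opcyclesIsCokernel (n + 1) n (by simp))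
  have h2 := (ShortComplex.moduleCat_exact_iff _).1 hex.unop x hx
  obtain ⟨z, hz⟩ := h2
  exact ⟨_, z, hz, rfl⟩

lemma Rel_eq (K : ChainComplex (ModuleCat.{u} R)ᵒᵖ ℕ) (n p : ℕ) (x x' : (K.X n).unop)
    (c c' : (K.homology n).unop) (h : Rel K n x c) (h' : Rel K n x' c') (y : (K.X p).unop)
    (hy : x - x' = (K.d n p).unop.hom y) : c = c' := by
  obtain ⟨z, rfl, rfl⟩ := h
  obtain ⟨z', rfl, rfl⟩ := h'
  have hm : Mono (K.pOpcycles n).unop := inferInstance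
  have hinj := (ModuleCat.mono_iff_injective _).1 hm
  have : z - z' = (K.fromOpcycles n p).unop.hom y := by
    apply hinj
    change (K.pOpcycles n).unop.hom _ = (K.pOpcycles n).unop.hom _
    rw [map_sub, hy, unop_comp_apply, HomologicalComplex.p_fromOpcycles]
  rw [← sub_eq_zero, ← map_sub, this, unop_comp_apply,
    HomologicalComplex.homologyι_comp_fromOpcycles]
  rfl

lemma Rel_map {K L : ChainComplex (ModuleCat.{u} R)ᵒᵖ ℕ} (φ : K ⟶ L) (n : ℕ) (x : (L.X n).unop)
    (c : (L.homology n).unop) (h : Rel L n x c) :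
    Rel K n ((φ.f n).unop.hom x) ((HomologicalComplex.homologyMap φ n).unop.hom c) := by
  obtain ⟨z, rfl, rfl⟩ := h
  refine ⟨(HomologicalComplex.opcyclesMap φ n).unop.hom z, ?_, ?_⟩
  · rw [unop_comp_apply, unop_comp_apply, HomologicalComplex.p_opcyclesMap]
  · rw [unop_comp_apply, unop_comp_apply, HomologicalComplex.homologyι_naturality]

lemma iso_inv_hom {A B : (ModuleCat.{u} R)ᵒᵖ} (e : A ≅ B) (x : B.unop) :
    e.inv.unop.hom (e.hom.unop.hom x) = x :=
  congrArg (fun k => k.unop.hom x) e.inv_hom_id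

lemma iso_hom_inv {A B : (ModuleCat.{u} R)ᵒᵖ} (e : A ≅ B) (x : A.unop) :
    e.hom.unop.hom (e.inv.unop.hom x) = x :=
  congrArg (fun k => k.unop.hom x) e.hom_inv_id

/-- the complex computing `Ext`. -/
noncomputable abbrev KK (P : ChainComplex (ModuleCat.{u} R) ℕ) (Y : ModuleCat.{u} R) :
    ChainComplex (ModuleCat.{u} R)ᵒᵖ ℕ :=
  (((linearYoneda R (ModuleCat.{u} R)).obj Y).rightOp.mapHomologicalComplex _).obj P

/-- the cocycle `f` represents the class `ξ`. -/
def Rep {X Y : ModuleCat.{u} R} (P : ProjectiveResolution X) {n : ℕ} (f : P.complex.X n ⟶ Y)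
    (ξ : ((Ext R (ModuleCat.{u} R) n).obj (op X)).obj Y) : Prop :=
  Rel (KK P.complex Y) n f
    ((P.isoLeftDerivedObj ((linearYoneda R (ModuleCat.{u} R)).obj Y).rightOp n).inv.unop.hom ξ)

variable {X Y : ModuleCat.{u} R} (P : ProjectiveResolution X) {n : ℕ}

lemma Rep_surj (ξ : ((Ext R (ModuleCat.{u} R) n).obj (op X)).obj Y) :
    ∃ f : P.complex.X n ⟶ Y, Rep P f ξ ∧ P.complex.d (n + 1) n ≫ f = 0 :=
  Rel_surj (KK P.complex Y) n
    ((P.isoLeftDerivedObj ((linearYoneda R (ModuleCat.{u} R)).obj Y).rightOp n).inv.unop.hom ξ)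

lemma Rep_exists (f : P.complex.X n ⟶ Y) (hf : P.complex.d (n + 1) n ≫ f = 0) :
    ∃ ξ, Rep P f ξ := by
  obtain ⟨c, hc⟩ := Rel_exists (KK P.complex Y) n f hf
  refine ⟨(P.isoLeftDerivedObj ((linearYoneda R (ModuleCat.{u} R)).obj Y).rightOp n).hom.unop.hom c,
    ?_⟩
  unfold Rep
  have e := iso_inv_hom
    (P.isoLeftDerivedObj ((linearYoneda R (ModuleCat.{u} R)).obj Y).rightOp n) c
  exact e.symm ▸ hc

lemma Rep_eq (p : ℕ) (f f' : P.complex.X n ⟶ Y)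
    (ξ ξ' : ((Ext R (ModuleCat.{u} R) n).obj (op X)).obj Y)
    (h : Rep P f ξ) (h' : Rep P f' ξ') (y : P.complex.X p ⟶ Y)
    (hy : f - f' = P.complex.d n p ≫ y) : ξ = ξ' := by
  have := Rel_eq (KK P.complex Y) n p f f' _ _ h h' y hy
  have := congrArg
    (P.isoLeftDerivedObj ((linearYoneda R (ModuleCat.{u} R)).obj Y).rightOp n).hom.unop.hom this
  exact (iso_hom_inv (P.isoLeftDerivedObj _ n) ξ).symm.trans
    (this.trans (iso_hom_inv (P.isoLeftDerivedObj _ n) ξ'))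

lemma Rep_map {X' : ModuleCat.{u} R} {P' : ProjectiveResolution X'} {g : X ⟶ X'}
    (φ : ProjectiveResolution.Hom P P' g) (f : P'.complex.X n ⟶ Y)
    (ξ : ((Ext R (ModuleCat.{u} R) n).obj (op X')).obj Y) (h : Rep P' f ξ) :
    Rep P (φ.hom.f n ≫ f) ((((Ext R (ModuleCat.{u} R) n).map g.op).app Y).hom ξ) := by
  have h1 := Rel_map ((((linearYoneda R (ModuleCat.{u} R)).obj Y).rightOp.mapHomologicalComplex
    _).map φ.hom) n _ _ h
  have nat := ProjectiveResolution.isoLeftDerivedObj_inv_naturality g P P' φ.hom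
    φ.hom_f_zero_comp_π_f_zero ((linearYoneda R (ModuleCat.{u} R)).obj Y).rightOp n
  have e : (P.isoLeftDerivedObj ((linearYoneda R (ModuleCat.{u} R)).obj Y).rightOp n).inv.unop.hom
      ((((Ext R (ModuleCat.{u} R) n).map g.op).app Y).hom ξ) = _ := 
    congrArg (fun k => k.unop.hom ξ) nat
  unfold Rep
  rw [e]
  exact h1

lemma extMk_zero_imp (f : P.complex.X n ⟶ Y) (hf : P.complex.d (n + 1) n ≫ f = 0)
    (h : P.extMk f (n + 1) rfl hf = 0) : ∃ p, ∃ y : P.complex.X p ⟶ Y, f = P.complex.d n p ≫ y := by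
  cases n with
  | succ p =>
    obtain ⟨y, hy⟩ := (P.extMk_eq_zero_iff f _ rfl hf p rfl).1 h
    exact ⟨p, y, hy.symm⟩
  | zero =>
    refine ⟨0, 0, ?_⟩
    rw [Limits.comp_zero]
    rw [← P.extEquivCohomologyClass.apply_eq_iff_eq,
      ProjectiveResolution.extEquivCohomologyClass_extMk,
      ProjectiveResolution.extEquivCohomologyClass_zero,
      CochainComplex.HomComplex.CohomologyClass.mk_eq_zero_iff,
      CochainComplex.HomComplex.Cocycle.toSingleMk_mem_coboundaries_iff _ _ _ _ _ 1 (by simp)] at h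
    obtain ⟨g, hg⟩ := h
    have hz : Limits.IsZero (P.cochainComplex.X 1) := 
      CochainComplex.isZero_of_isStrictlyLE _ 0 1 (by simp)
    rw [hz.eq_of_src g 0, Limits.comp_zero] at hg
    rw [← cancel_epi (P.cochainComplexXIso (-((0 : ℕ) : ℤ)) 0 rfl).hom, Limits.comp_zero]
    exact hg.symm

lemma exists_hom {X X' : ModuleCat.{u} R} (P : ProjectiveResolution X) (P' : ProjectiveResolution X')
    (g : X ⟶ X') : Nonempty (ProjectiveResolution.Hom P P' g) :=
  ⟨⟨ProjectiveResolution.lift g P P', by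
    have := ProjectiveResolution.lift_commutes_zero g P P'
    simpa using this⟩⟩

/-- transport of equalities from Yoneda `Ext` to derived-functor `Ext`. -/
lemma transport {X₁ Y : ModuleCat.{u} R} (n : ℕ) 
    (ξ : ((Ext R (ModuleCat.{u} R) n).obj (op X₁)).obj Y) :
    ∃ ξ' : Abelian.Ext X₁ Y n, ∀ (X X₂ : ModuleCat.{u} R) (g₁ : X ⟶ X₁) (g₂ : X ⟶ X₂)
      (ζ' : Abelian.Ext X₂ Y n), (Abelian.Ext.mk₀ g₁).comp ξ' (zero_add n) =
        (Abelian.Ext.mk₀ g₂).comp ζ' (zero_add n) →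
      ∃ ζ : ((Ext R (ModuleCat.{u} R) n).obj (op X₂)).obj Y,
      (((Ext R (ModuleCat.{u} R) n).map g₁.op).app Y).hom ξ =
        (((Ext R (ModuleCat.{u} R) n).map g₂.op).app Y).hom ζ := by
  let P₁ := projectiveResolution X₁
  obtain ⟨f, hfr, hf⟩ := Rep_surj P₁ ξ
  refine ⟨P₁.extMk f (n + 1) rfl hf, ?_⟩
  intro X X₂ g₁ g₂ ζ' heq
  let P := projectiveResolution X
  let P₂ := projectiveResolution X₂
  obtain ⟨k, hk, rfl⟩ := P₂.extMk_surjective ζ' (n + 1) rfl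
  obtain ⟨φ₁⟩ := exists_hom P P₁ g₁
  obtain ⟨φ₂⟩ := exists_hom P P₂ g₂
  obtain ⟨ζ, hζ⟩ := Rep_exists P₂ k hk
  rw [ProjectiveResolution.mk₀_comp_extMk (φ := φ₁), ProjectiveResolution.mk₀_comp_extMk (φ := φ₂),
    ← sub_eq_zero, ProjectiveResolution.sub_extMk] at heq
  obtain ⟨p, y, hy⟩ := extMk_zero_imp _ _ _ heq
  exact ⟨ζ, Rep_eq P p _ _ _ _ (Rep_map P φ₁ f ξ hfr) (Rep_map P φ₂ k ζ hζ) y hy⟩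

end OldExt
end LCaux

namespace LCaux
section Final
open Opposite Limits localCohomology

variable {R : Type u} [CommRing R]

/-- The maps `R/a^t → R/b^t`. -/
def powMap {a b : Ideal R} (hab : a ≤ b) :
    ringModIdeals (idealPowersDiagram a) ⟶ ringModIdeals (idealPowersDiagram b) where
  app t := qm (Ideal.pow_right_mono hab t.unop)
  naturality s t f := (qm_comp (Ideal.pow_le_pow_right f.unop.down.down)
    (Ideal.pow_right_mono hab t.unop)).trans (qm_comp (Ideal.pow_right_mono hab s.unop)
    (Ideal.pow_le_pow_right f.unop.down.down)).symm

/-- The induced map of Ext diagrams. -/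
def diagMap {a b : Ideal R} (hab : a ≤ b) (n : ℕ) :
    diagram (idealPowersDiagram b) n ⟶ diagram (idealPowersDiagram a) n :=
  Functor.whiskerRight (NatTrans.op (powMap hab)) (Ext R (ModuleCat.{u} R) n)

/-- The induced map on local cohomology. -/
def lcMap {a b : Ideal R} (hab : a ≤ b) (n : ℕ) :
    localCohomology b n ⟶ localCohomology a n :=
  colimMap (diagMap hab n)

/-- The map from a stage. -/
def stage (a : Ideal R) (n : ℕ) (t : ℕ) :
    (Ext R (ModuleCat.{u} R) n).obj (op (ModuleCat.of R (R ⧸ a ^ t))) ⟶ localCohomology a n :=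
  colimit.ι (diagram (idealPowersDiagram a) n) (op (op t))

lemma stage_w (a : Ideal R) (n : ℕ) {t s : ℕ} (h : t ≤ s) :
    (Ext R (ModuleCat.{u} R) n).map (qm (Ideal.pow_le_pow_right (I := a) h)).op ≫ stage a n s =
      stage a n t :=
  colimit.w (diagram (idealPowersDiagram a) n) (homOfLE h).op.op

lemma stage_lcMap {a b : Ideal R} (hab : a ≤ b) (n : ℕ) (s : ℕ) :
    stage b n s ≫ lcMap hab n =
      (Ext R (ModuleCat.{u} R) n).map (qm (Ideal.pow_right_mono hab s)).op ≫ stage a n s :=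
  ι_colimMap (diagMap hab n) (op (op s))

lemma stage_surj (a : Ideal R) (n : ℕ) (M : ModuleCat.{u} R) (x : (localCohomology a n).obj M) :
    ∃ t, ∃ ξ : ((Ext R (ModuleCat.{u} R) n).obj (op (ModuleCat.of R (R ⧸ a ^ t)))).obj M,
      ((stage a n t).app M).hom ξ = x := by
  let D := diagram (idealPowersDiagram a) n
  have hF : PreservesFilteredColimitsOfSize.{0, 0} (forget (ModuleCat.{u} R)) :=
    preservesFilteredColimitsOfSize_shrink.{0, u, 0, u} _
  have hF' : PreservesColimitsOfShape ℕᵒᵖᵒᵖ (forget (ModuleCat.{u} R)) :=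
    hF.preserves_filtered_colimits ℕᵒᵖᵒᵖ
  have hc := isColimitOfPreserves (forget (ModuleCat.{u} R))
    (isColimitOfPreserves ((evaluation (ModuleCat.{u} R) (ModuleCat.{u} R)).obj M)
    (colimit.isColimit D))
  obtain ⟨j, y, hy⟩ := Types.jointly_surjective _ hc x
  exact ⟨j.unop.unop, y, hy⟩

end Final
end LCaux

theorem stmt5 (R : Type u) [CommRing R] [IsNoetherianRing R] [IsLocalRing R]
    (a b : Ideal R) (ha : a ≠ ⊤) (hb : b ≠ ⊤) (hab : a ≤ b)
    (M : Type u) [AddCommGroup M] [Module R M] [Module.Finite R M]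
    (n : ℕ) (hdim : mdim R M = (n : ℕ∞)) :
    ∃ f : (LC b n M) →ₗ[R] (LC a n M), Function.Surjective f := by
  refine ⟨((LCaux.lcMap hab n).app (ModuleCat.of R M)).hom, ?_⟩
  intro x
  obtain ⟨t, ξ, rfl⟩ := LCaux.stage_surj a n _ x
  obtain ⟨ξ', hξ'⟩ := LCaux.transport n ξ
  obtain ⟨s, hs, ζ', hζ'⟩ := LCaux.main_stage a b hb hab n M (le_of_eq hdim) t ξ'
  obtain ⟨ζ, hζ⟩ := hξ' _ _ _ _ ζ' hζ'
  refine ⟨((LCaux.stage b n s).app (ModuleCat.of R M)).hom ζ, ?_⟩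
  have h1 := congrArg (fun k => (k.app (ModuleCat.of R M)).hom ζ) (LCaux.stage_lcMap hab n s)
  have h2 := congrArg (fun k => (k.app (ModuleCat.of R M)).hom ξ) (LCaux.stage_w a n hs)
  have h3 := congrArg ((LCaux.stage a n s).app (ModuleCat.of R M)).hom hζ
  exact h1.trans (h3.symm.trans h2)

end
end

section
/- Let (R, m) be a commutative Noetherian local ring, M a finitely generated R-module of dimension n, and a ⊆ b proper ideals. Then Att(H_a^n(M)) ⊆ Att(H_b^n(M)). In particular, if H_a^n(M) ≠ 0 then H_b^n(M) ≠ 0. -/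
noncomputable section

universe u

open CategoryTheory

namespace Stmt6Aux

open CategoryTheory Abelian

variable {R : Type u} [CommRing R]

section basics

variable {A B C A' B' C' : Type u} [AddCommGroup A] [Module R A] [AddCommGroup B] [Module R B]
  [AddCommGroup A'] [Module R A'] [AddCommGroup B'] [Module R B'] [AddCommGroup C'] [Module R C']
  [AddCommGroup C] [Module R C]

/-- Ext groups of modules. -/
abbrev E (R : Type u) [CommRing R] (A B : Type u) [AddCommGroup A] [Module R A]
    [AddCommGroup B] [Module R B] (i : ℕ) : Type u :=
  Ext.{u} (ModuleCat.of R A) (ModuleCat.of R B) i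

/-- Pullback of an Ext class. -/
def pull (f : A →ₗ[R] B) {i : ℕ} (x : E R B C i) : E R A C i :=
  (Ext.mk₀ (ModuleCat.ofHom f)).comp x (zero_add i)

/-- Pushforward of an Ext class. -/
def push (f : B →ₗ[R] C) {i : ℕ} (x : E R A B i) : E R A C i :=
  x.comp (Ext.mk₀ (ModuleCat.ofHom f)) (add_zero i)

lemma pull_comp (f : A →ₗ[R] B) (g : B →ₗ[R] C) {i : ℕ} (x : E R C C' i) :
    pull (g ∘ₗ f) x = pull f (pull g x) := by
  simp [pull, ModuleCat.ofHom_comp]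

lemma push_pull (f : A →ₗ[R] B) (g : C →ₗ[R] C') {i : ℕ} (x : E R B C i) :
    push g (pull f x) = pull f (push g x) := by
  simp only [push, pull]
  rw [Ext.comp_assoc]
  omega

@[simp] lemma pull_zero (f : A →ₗ[R] B) {i : ℕ} : pull f (0 : E R B C i) = 0 := by
  simp [pull]

@[simp] lemma push_zero (f : B →ₗ[R] C) {i : ℕ} : push f (0 : E R A B i) = 0 := by
  simp [push]

@[simp] lemma zero_pull {i : ℕ} (x : E R B C i) : pull (0 : A →ₗ[R] B) x = 0 := by
  simp [pull]

@[simp] lemma pull_smul (f : A →ₗ[R] B) {i : ℕ} (r : R) (x : E R B C i) :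
    pull f (r • x) = r • pull f x := by
  simp [pull, Ext.comp_smul]

@[simp] lemma push_smul (f : B →ₗ[R] C) {i : ℕ} (r : R) (x : E R A B i) :
    push f (r • x) = r • push f x := by
  simp [push, Ext.smul_comp]

lemma smul_pull (f : A →ₗ[R] B) {i : ℕ} (r : R) (x : E R B C i) :
    pull (r • f) x = r • pull f x := by
  have : ModuleCat.ofHom (r • f) = r • ModuleCat.ofHom f := rfl
  simp [pull, this, Ext.mk₀_smul, Ext.smul_comp]

lemma smul_push (f : B →ₗ[R] C) {i : ℕ} (r : R) (x : E R A B i) :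
    push (r • f) x = r • push f x := by
  have : ModuleCat.ofHom (r • f) = r • ModuleCat.ofHom f := rfl
  simp [push, this, Ext.mk₀_smul, Ext.comp_smul]

lemma id_pull {i : ℕ} (x : E R B C i) : pull (LinearMap.id) x = x := by
  simp [pull]

lemma id_push {i : ℕ} (x : E R B C i) : push (LinearMap.id) x = x := by
  simp [push]

/-- short complex from linear maps. -/
abbrev sc (f : A →ₗ[R] B) (g : B →ₗ[R] C) (h : Function.Exact f g) :
    ShortComplex (ModuleCat.{u} R) :=
  ShortComplex.mk (ModuleCat.ofHom f) (ModuleCat.ofHom g) (by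
    ext x
    exact h.apply_apply_eq_zero x)

lemma sc_exact (f : A →ₗ[R] B) (g : B →ₗ[R] C) (h : Function.Exact f g)
    (hf : Function.Injective f) (hg : Function.Surjective g) : (sc f g h).ShortExact :=
  ModuleCat.shortComplex_shortExact _ h hf hg

lemma exists_pull_eq (f : A →ₗ[R] B) (g : B →ₗ[R] C) (h : Function.Exact f g)
    (hf : Function.Injective f) (hg : Function.Surjective g) {i : ℕ} (x : E R B C' i)
    (hx : pull f x = 0) : ∃ y : E R C C' i, pull g y = x :=
  Ext.contravariant_sequence_exact₂ (sc_exact f g h hf hg) _ x hx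

lemma exists_push_eq (f : A →ₗ[R] B) (g : B →ₗ[R] C) (h : Function.Exact f g)
    (hf : Function.Injective f) (hg : Function.Surjective g) {i : ℕ} (x : E R C' B i)
    (hx : push g x = 0) : ∃ y : E R C' A i, push f y = x :=
  Ext.covariant_sequence_exact₂ _ (sc_exact f g h hf hg) x hx

/-- connecting map in the second variable, as a relation. -/
lemma exists_delta (f : A →ₗ[R] B) (g : B →ₗ[R] C) (h : Function.Exact f g)
    (hf : Function.Injective f) (hg : Function.Surjective g) {i : ℕ} (x : E R C' A (i + 1))
    (hx : push f x = 0) : ∃ y : E R C' C i, ∀ (D : Type u) [AddCommGroup D] [Module R D]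
      (p : D →ₗ[R] C') (r : R), r • pull p y = 0 → r • pull p x = 0 := by
  obtain ⟨y, hy⟩ := Ext.covariant_sequence_exact₁ _ (sc_exact f g h hf hg) x hx rfl
  refine ⟨y, fun D _ _ p r hr => ?_⟩
  rw [← hy]
  have : r • pull p (y.comp (sc_exact f g h hf hg).extClass rfl : E R C' A (i+1)) =
      (r • pull p y).comp (sc_exact f g h hf hg).extClass rfl := by
    rw [Ext.smul_comp]
    congr 1
    exact (Ext.comp_assoc _ _ _ _ _ (by omega)).symm
  rw [this, hr]
  simp

lemma exists_delta' (f : A →ₗ[R] B) (g : B →ₗ[R] C) (h : Function.Exact f g)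
    (hf : Function.Injective f) (hg : Function.Surjective g) {i : ℕ} {M : Type u}
    [AddCommGroup M] [Module R M] (x : E R C M (i + 1))
    (hx : pull g x = 0) : ∃ y : E R A M i, 
      ∀ (A' B' C' : Type u) [AddCommGroup A'] [Module R A'] [AddCommGroup B'] [Module R B']
      [AddCommGroup C'] [Module R C'] (f' : A' →ₗ[R] B') (g' : B' →ₗ[R] C')
      (_ : Function.Exact f' g') (_ : Function.Injective f') (_ : Function.Surjective g')
      (α : A' →ₗ[R] A) (β : B' →ₗ[R] B) (γ : C' →ₗ[R] C)
      (_ : f ∘ₗ α = β ∘ₗ f') (_ : g ∘ₗ β = γ ∘ₗ g'), pull α y = 0 → pull γ x = 0 := by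
  obtain ⟨y, hy⟩ := Ext.contravariant_sequence_exact₃ (sc_exact f g h hf hg) _ x hx (add_comm 1 i)
  refine ⟨y, fun A' B' C' _ _ _ _ _ _ f' g' h' hf' hg' α β γ h1 h2 hr => ?_⟩
  let φ : sc f' g' h' ⟶ sc f g h :=
    { τ₁ := ModuleCat.ofHom α
      τ₂ := ModuleCat.ofHom β
      τ₃ := ModuleCat.ofHom γ
      comm₁₂ := by
        simp only [sc, ← ModuleCat.ofHom_comp, h1]
      comm₂₃ := by
        simp only [sc, ← ModuleCat.ofHom_comp, h2] }
  have nat := ShortComplex.ShortExact.extClass_naturality (sc_exact f' g' h' hf' hg')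
    (sc_exact f g h hf hg) φ
  rw [← hy]
  have e1 : (Ext.mk₀ (ModuleCat.ofHom γ)).comp
      ((sc_exact f g h hf hg).extClass.comp y (add_comm 1 i)) (zero_add (i+1)) =
      ((Ext.mk₀ φ.τ₃).comp (sc_exact f g h hf hg).extClass (zero_add 1)).comp y
        (add_comm 1 i) := by
    rw [Ext.comp_assoc]
    omega
  refine e1.trans ?_
  rw [← nat]
  rw [Ext.comp_assoc _ _ _ _ (zero_add i) (by omega)]
  change Ext.comp _ (pull α y) _ = 0
  rw [hr, Ext.comp_zero]

end basics

lemma torsion_step [IsNoetherianRing R] (a : Ideal R) (M : Type u) [AddCommGroup M] [Module R M]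
    (i : ℕ) (K F N : Type u) [AddCommGroup K] [Module R K] [AddCommGroup F] [Module R F]
    [AddCommGroup N] [Module R N] [Module.Finite R F] (ι : K →ₗ[R] F) (π : F →ₗ[R] N)
    (hex : Function.Exact ι π) (hι : Function.Injective ι) (hπ : Function.Surjective π)
    (hpr : Projective (ModuleCat.of R F))
    (ih : ∀ y : E R K M i, ∃ s : ℕ, pull (a ^ s • (⊤ : Submodule R K)).subtype y = 0)
    (x : E R N M (i + 1)) : ∃ s : ℕ, pull (a ^ s • (⊤ : Submodule R N)).subtype x = 0 := by
  obtain ⟨y, hy⟩ := exists_delta' ι π hex hι hπ x (Ext.eq_zero_of_projective _)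
  obtain ⟨s, hs⟩ := ih y
  obtain ⟨k, hk⟩ := Ideal.exists_pow_inf_eq_pow_smul a (LinearMap.range ι)
  refine ⟨s + k, ?_⟩
  have hAR : (a ^ (s + k) • (⊤ : Submodule R F)).comap ι ≤ a ^ s • (⊤ : Submodule R K) := by
    intro v hv
    have h1 : ι v ∈ a ^ (s + k) • (⊤ : Submodule R F) ⊓ LinearMap.range ι := ⟨hv, v, rfl⟩
    rw [hk _ (by omega), Nat.add_sub_cancel] at h1
    have h2 : ι v ∈ a ^ s • LinearMap.range ι :=
      (smul_mono_right _ inf_le_right : a ^ s • (a ^ k • ⊤ ⊓ LinearMap.range ι) ≤ _) h1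
    have h3 : (a ^ s • (⊤ : Submodule R K)).map ι = a ^ s • LinearMap.range ι := by
      rw [Submodule.map_smul'', Submodule.map_top]
    rw [← h3] at h2
    obtain ⟨w, hw, hwv⟩ := h2
    rwa [← hι hwv]
  have h1 : (a ^ (s + k) • (⊤ : Submodule R F)).map π = a ^ (s + k) • (⊤ : Submodule R N) := by
    rw [Submodule.map_smul'', Submodule.map_top, LinearMap.range_eq_top.2 hπ]
  have hmap : ∀ v ∈ a ^ (s + k) • (⊤ : Submodule R F),
      π v ∈ a ^ (s + k) • (⊤ : Submodule R N) := by
    intro v hv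
    rw [← h1]
    exact Submodule.mem_map_of_mem hv
  have hπ' : Function.Surjective (π.restrict hmap) := by
    rintro ⟨v, hv⟩
    obtain ⟨w, hw, rfl⟩ := h1.symm ▸ hv
    exact ⟨⟨w, hw⟩, rfl⟩
  let ι' : (a ^ (s + k) • (⊤ : Submodule R F)).comap ι →ₗ[R]
      (a ^ (s + k) • (⊤ : Submodule R F) : Submodule R F) := ι.restrict (fun _ h => h)
  have hι' : Function.Injective ι' := by
    rintro ⟨v, hv⟩ ⟨w, hw⟩ h
    exact Subtype.ext (hι (congrArg Subtype.val h))
  have hex' : Function.Exact ι' (π.restrict hmap) := by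
    rintro ⟨v, hv⟩
    constructor
    · intro h
      obtain ⟨w, rfl⟩ := (hex v).1 (congrArg Subtype.val h)
      exact ⟨⟨w, hv⟩, rfl⟩
    · rintro ⟨w, hw⟩
      exact Subtype.ext ((hex v).2 ⟨w.1, congrArg Subtype.val hw⟩)
  refine hy _ _ _ ι' (π.restrict hmap) hex' hι' hπ'
    ((a ^ s • (⊤ : Submodule R K)).subtype ∘ₗ Submodule.inclusion hAR)
    (Submodule.subtype _) _ (LinearMap.ext fun _ => rfl) (LinearMap.ext fun _ => rfl) ?_
  rw [pull_comp, hs, pull_zero]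

/-- Torsion coefficients: classes are killed by restriction to `a ^ s N`. -/
lemma torsion_aux [IsNoetherianRing R] (a : Ideal R) (M : Type u) [AddCommGroup M] [Module R M]
    (hM : ∀ x ∈ a, ∀ m : M, x • m = 0) (i : ℕ) :
    ∀ (N : Type u) [AddCommGroup N] [Module R N] [Module.Finite R N] (x : E R N M i),
      ∃ s : ℕ, pull (a ^ s • (⊤ : Submodule R N)).subtype x = 0 := by
  induction i with
  | zero =>
    intro N _ _ _ x
    obtain ⟨f, rfl⟩ := (Ext.mk₀_bijective _ _).2 x
    refine ⟨1, ?_⟩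
    rw [pull, Ext.mk₀_comp_mk₀]
    have : ModuleCat.ofHom (a ^ 1 • (⊤ : Submodule R N)).subtype ≫ f = 0 := by
      ext y
      obtain ⟨y, hy⟩ := y
      change f.hom y = 0
      rw [pow_one] at hy
      induction hy using Submodule.smul_induction_on' with
      | smul r hr n hn => rw [map_smul]; exact hM _ hr _
      | add x hx y hy h1 h2 => rw [map_add, h1, h2, add_zero]
    rw [this, Ext.mk₀_zero]
  | succ i ih =>
    intro N _ _ _ x
    obtain ⟨r, π, hπ⟩ := Module.Finite.exists_fin' R N
    have hpr : Projective (ModuleCat.of R (Fin r → R)) :=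
      ModuleCat.projective_of_free (Pi.basisFun R (Fin r))
    exact torsion_step a M i _ _ N (LinearMap.ker π).subtype π
      (LinearMap.exact_subtype_ker_map π) (Submodule.subtype_injective _) hπ hpr
      (ih (LinearMap.ker π)) x

/-- Transition map between quotients. -/
abbrev tr {I J : Ideal R} (h : I ≤ J) : (R ⧸ I) →ₗ[R] (R ⧸ J) :=
  Submodule.mapQ I J LinearMap.id h

lemma tr_comp {I J K : Ideal R} (h : I ≤ J) (h' : J ≤ K) : tr h' ∘ₗ tr h = tr (h.trans h') := by
  apply Submodule.linearMap_qext
  rfl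

lemma tr_self {I : Ideal R} : tr (le_refl I) = LinearMap.id := by
  apply Submodule.linearMap_qext
  rfl

lemma pow_le {a : Ideal R} {s t : ℕ} (h : t ≤ s) : a ^ s ≤ a ^ t := Ideal.pow_le_pow_right h

lemma torsion_van [IsNoetherianRing R] (a : Ideal R) (M : Type u) [AddCommGroup M] [Module R M]
    (hM : ∀ x ∈ a, ∀ m : M, x • m = 0) (i t : ℕ) (x : E R (R ⧸ a ^ t) M (i + 1)) :
    ∃ s, ∃ h : t ≤ s, pull (tr (pow_le (a := a) h)) x = 0 := by
  have hpr : Projective (ModuleCat.of R R) :=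
      ModuleCat.projective_of_free (Module.Basis.singleton Unit R)
  have hex : ∀ I : Ideal R, Function.Exact I.subtype (Submodule.mkQ I) := fun I =>
    LinearMap.exact_subtype_mkQ I
  obtain ⟨y, hy⟩ := exists_delta' (a ^ t).subtype (Submodule.mkQ (a ^ t)) (hex _)
    (Submodule.subtype_injective _) (Submodule.mkQ_surjective _) x
      (Ext.eq_zero_of_projective _)
  obtain ⟨s, hs⟩ := torsion_aux a M hM i _ y
  refine ⟨s + t, by omega, ?_⟩
  have hm : ∀ v : R, v ∈ a ^ (s + t) → ∃ hv : v ∈ a ^ t, 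
      (⟨v, hv⟩ : (a ^ t : Ideal R)) ∈ a ^ s • (⊤ : Submodule R (a ^ t : Ideal R)) := by
    intro v hv
    have h3 : (a ^ s • (⊤ : Submodule R (a ^ t : Ideal R))).map (a ^ t).subtype = a ^ (s + t) := by
      rw [Submodule.map_smul'', Submodule.map_top, Submodule.range_subtype, pow_add]
      rfl
    rw [← h3] at hv
    obtain ⟨w, hw, rfl⟩ := hv
    exact ⟨w.2, hw⟩
  let α : (a ^ (s + t) : Ideal R) →ₗ[R] (a ^ s • (⊤ : Submodule R (a ^ t : Ideal R)) : Submodule R _) :=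
      { toFun := fun v => ⟨⟨v.1, (hm v.1 v.2).1⟩, (hm v.1 v.2).2⟩
        map_add' := fun _ _ => rfl
        map_smul' := fun _ _ => rfl }
  refine hy _ _ _ (a ^ (s + t)).subtype (Submodule.mkQ _) (hex _)
      (Submodule.subtype_injective _) (Submodule.mkQ_surjective _) ((Submodule.subtype _) ∘ₗ α)
      LinearMap.id _ rfl rfl ?_
  rw [pull_comp, hs, pull_zero]


/-- `H_a^i(M)_x = 0`, expressed on Ext classes. -/
def Van (a : Ideal R) (x : R) (i : ℕ) (M : Type u) [AddCommGroup M] [Module R M] : Prop :=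
  ∀ (t : ℕ) (z : E R (R ⧸ a ^ t) M i), ∃ s, ∃ h : t ≤ s, ∃ k : ℕ,
    x ^ k • pull (tr (pow_le (a := a) h)) z = 0

lemma van_of_smul (a : Ideal R) (x : R) (i : ℕ) (M : Type u) [AddCommGroup M] [Module R M]
    (h : ∀ m : M, x • m = 0) : Van a x i M := by
  intro t z
  refine ⟨t, le_rfl, 1, ?_⟩
  have h0 : x • (LinearMap.id : M →ₗ[R] M) = 0 := LinearMap.ext h
  rw [← id_push (pull _ z), pow_one, ← smul_push, h0]
  simp [push]

lemma van_exact (a : Ideal R) (x : R) (i : ℕ) {A B C : Type u} [AddCommGroup A] [Module R A]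
    [AddCommGroup B] [Module R B] [AddCommGroup C] [Module R C]
    (f : A →ₗ[R] B) (g : B →ₗ[R] C) (h : Function.Exact f g)
    (hf : Function.Injective f) (hg : Function.Surjective g)
    (hA : Van a x i A) (hC : Van a x i C) : Van a x i B := by
  intro t z
  obtain ⟨s, hs, k, hk⟩ := hC t (push g z)
  rw [← push_pull, ← push_smul] at hk
  obtain ⟨y, hy⟩ := exists_push_eq f g h hf hg _ hk
  obtain ⟨s', hs', k', hk'⟩ := hA s y
  refine ⟨s', hs.trans hs', k' + k, ?_⟩
  have h1 := congrArg (push f) hk'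
  rw [push_smul, push_pull, hy, pull_smul, push_zero, ← pull_comp, tr_comp, smul_smul,
    ← pow_add] at h1
  exact h1

/-- Dimension condition on `M` away from `x`. -/
def Dm (x : R) (n : ℕ) (M : Type u) [AddCommGroup M] [Module R M] : Prop :=
  ∀ l : LTSeries (PrimeSpectrum R), l.head ∈ Module.support R M → x ∉ l.last.asIdeal → l.length < n

lemma van_delta (a : Ideal R) (x y : R) (hy : y ∈ a) (i : ℕ) {A C : Type u} [AddCommGroup A]
    [Module R A] [AddCommGroup C] [Module R C]
    (g : A →ₗ[R] C) (h : Function.Exact (y • (LinearMap.id : A →ₗ[R] A)) g)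
    (hf : Function.Injective (y • (LinearMap.id : A →ₗ[R] A))) (hg : Function.Surjective g)
    (hC : Van a x i C) : Van a x (i + 1) A := by
  have key : ∀ (j t : ℕ) (z : E R (R ⧸ a ^ t) A (i + 1)), y ^ j • z = 0 →
      ∃ s, ∃ h : t ≤ s, ∃ k : ℕ, x ^ k • pull (tr (pow_le (a := a) h)) z = 0 := by
    intro j
    induction j with
    | zero =>
      intro t z hz
      rw [pow_zero, one_smul] at hz
      exact ⟨t, le_rfl, 0, by simp [hz]⟩
    | succ j ih =>
      intro t z hz
      obtain ⟨w, hw⟩ := exists_delta _ g h hf hg (y ^ j • z) (by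
        rw [smul_push, id_push, smul_smul, ← pow_succ', hz])
      obtain ⟨s, hs, k, hk⟩ := hC t w
      have h1 := hw (R ⧸ a ^ s) (tr (pow_le (a := a) hs)) (x ^ k) hk
      rw [pull_smul, smul_smul, mul_comm, ← smul_smul] at h1
      obtain ⟨s', hs', k', hk'⟩ := ih s (x ^ k • pull (tr (pow_le (a := a) hs)) z) h1
      refine ⟨s', hs.trans hs', k' + k, ?_⟩
      rw [pull_smul, ← pull_comp, tr_comp, smul_smul, ← pow_add] at hk'
      exact hk'
  intro t z
  refine key t t z ?_
  have h0 : y ^ t • (LinearMap.id : (R ⧸ a ^ t) →ₗ[R] (R ⧸ a ^ t)) = 0 := by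
    apply Submodule.linearMap_qext
    ext
    change Submodule.Quotient.mk (y ^ t • (1 : R)) = 0
    rw [Submodule.Quotient.mk_eq_zero]
    simpa using Ideal.pow_mem_pow hy t
  rw [← id_pull z, ← smul_pull, h0, zero_pull]

theorem van_main [IsNoetherianRing R] (a : Ideal R) (x : R) (n : ℕ) :
    ∀ (M : Type u) [AddCommGroup M] [Module R M] [Module.Finite R M], Dm x n M →
      ∀ i, n ≤ i → Van a x i M := by
  induction n with
  | zero =>
    intro M _ _ hfin
    induction hfin using IsNoetherianRing.induction_on_isQuotientEquivQuotientPrime R with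
    | subsingleton N => exact fun _ i _ => van_of_smul _ _ _ _ fun _ => Subsingleton.elim _ _
    | quotient N p f =>
      intro hd i hi
      refine van_of_smul _ _ _ _ fun m => ?_
      by_contra hne
      have hx : x ∉ p.asIdeal := by
        intro hx
        apply hne
        apply f.injective
        rw [map_smul, map_zero]
        obtain ⟨r, hr⟩ := Submodule.mkQ_surjective _ (f m)
        rw [← hr, ← map_smul]
        exact (Submodule.Quotient.mk_eq_zero _).2 (p.asIdeal.mul_mem_right r hx)
      have := hd (RelSeries.singleton _ p) (by
        rw [f.support_eq]
        simp [Module.mem_support_iff_of_finite, Ideal.annihilator_quotient]) hx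
      omega
    | exact N₁ N₂ N₃ f g hf hg hfg h₁ h₃ =>
      intro hd i hi
      have hs := Module.support_of_exact hfg hf hg
      exact van_exact a x i f g hfg hf hg
        (h₁ (fun l hl => hd l (hs ▸ Or.inl hl)) i hi) (h₃ (fun l hl => hd l (hs ▸ Or.inr hl)) i hi)
  | succ n IH =>
    intro M _ _ hfin
    induction hfin using IsNoetherianRing.induction_on_isQuotientEquivQuotientPrime R with
    | subsingleton N => exact fun _ i _ => van_of_smul _ _ _ _ fun _ => Subsingleton.elim _ _
    | quotient N p f =>
      intro hd i hi
      obtain ⟨i, rfl⟩ : ∃ j, i = j + 1 := ⟨i - 1, by omega⟩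
      have hsupp : ∀ q : PrimeSpectrum R, q ∈ Module.support R N ↔ p ≤ q := by
        intro q
        rw [f.support_eq]
        simp [Module.mem_support_iff_of_finite, Ideal.annihilator_quotient]
      have hker : ∀ y ∈ p.asIdeal, ∀ m : N, y • m = 0 := by
        intro y hy m
        apply f.injective
        rw [map_smul, map_zero]
        obtain ⟨r, hr⟩ := Submodule.mkQ_surjective _ (f m)
        rw [← hr, ← map_smul]
        exact (Submodule.Quotient.mk_eq_zero _).2 (p.asIdeal.mul_mem_right r hy)
      by_cases hap : a ≤ p.asIdeal
      · intro t z
        obtain ⟨s, hs, h⟩ := torsion_van a N (fun y hy => hker y (hap hy)) i t z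
        exact ⟨s, hs, 0, by rw [h, smul_zero]⟩
      · obtain ⟨y, hya, hyp⟩ := SetLike.not_le_iff_exists.1 hap
        have hinj : Function.Injective (y • (LinearMap.id : N →ₗ[R] N)) := by
          rw [injective_iff_map_eq_zero]
          intro m hm
          have hm' : y • m = 0 := hm
          apply f.injective
          rw [map_zero]
          have := congrArg f hm'
          rw [map_smul, map_zero] at this
          obtain ⟨r, hr⟩ := Submodule.mkQ_surjective _ (f m)
          rw [← hr] at this ⊢
          rw [← map_smul] at this
          simp only [Submodule.mkQ_apply, Submodule.Quotient.mk_eq_zero, smul_eq_mul] at this ⊢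
          exact (p.2.mem_or_mem this).resolve_left hyp
        refine van_delta a x y hya i (LinearMap.range (y • (LinearMap.id : N →ₗ[R] N))).mkQ
          (LinearMap.exact_map_mkQ_range _) hinj (Submodule.mkQ_surjective _) ?_
        refine IH _ ?_ i (by omega)
        intro l hl hx
        have h1 : l.head ∈ Module.support R N :=
          Module.support_subset_of_surjective _ (Submodule.mkQ_surjective _) hl
        have h2 : y ∈ l.head.asIdeal := by
          rw [Module.mem_support_iff_of_finite] at hl
          apply hl
          rw [Module.mem_annihilator]
          intro m
          obtain ⟨m, rfl⟩ := Submodule.mkQ_surjective _ m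
          rw [← map_smul, Submodule.mkQ_apply, Submodule.Quotient.mk_eq_zero]
          exact ⟨m, rfl⟩
        have h3 : p < l.head := lt_of_le_of_ne ((hsupp _).1 h1) (by
          intro h
          rw [← h] at h2
          exact hyp h2)
        have := hd (l.cons p h3) (by rw [RelSeries.head_cons, hsupp]) (by
          rwa [RelSeries.last_cons])
        simp at this
        omega
    | exact N₁ N₂ N₃ f g hf hg hfg h₁ h₃ =>
      intro hd i hi
      have hs := Module.support_of_exact hfg hf hg
      exact van_exact a x i f g hfg hf hg
        (h₁ (fun l hl => hd l (hs ▸ Or.inl hl)) i hi) (h₃ (fun l hl => hd l (hs ▸ Or.inr hl)) i hi)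

/-- classes killed by a power of `x` come from the bigger ideal. -/
lemma step [IsNoetherianRing R] (a : Ideal R) (x : R) (i : ℕ) (M : Type u) [AddCommGroup M]
    [Module R M] (hv : Van a x i M) (t : ℕ) (z : E R (R ⧸ a ^ t) M i) :
    ∃ s, ∃ h : t ≤ s, ∃ y : E R (R ⧸ (a ⊔ Ideal.span {x}) ^ s) M i,
      pull (tr (Ideal.pow_right_mono le_sup_left s)) y = pull (tr (pow_le (a := a) h)) z := by
  obtain ⟨s, hs, k, hk⟩ := hv t z
  set z' := pull (tr (pow_le (a := a) hs)) z with hz'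
  obtain ⟨l, hl⟩ : ∃ l, ∀ r : R, x ^ (l + k) * r = 0 → x ^ l * r = 0 := by
    obtain ⟨l, hl⟩ := monotone_stabilizes_iff_noetherian.2 (inferInstance : IsNoetherian R R)
      ⟨fun l => LinearMap.ker (LinearMap.mulLeft R (x ^ l)), by
        intro p q hpq r hr
        rw [LinearMap.mem_ker, LinearMap.mulLeft_apply] at hr ⊢
        obtain ⟨d, rfl⟩ := Nat.exists_eq_add_of_le hpq
        rw [pow_add, mul_right_comm, hr, zero_mul]⟩
    refine ⟨l, fun r hr => ?_⟩
    have h1 := hl (l + k) (by omega)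
    have h2 : r ∈ LinearMap.ker (LinearMap.mulLeft R (x ^ (l + k))) := hr
    have h3 : r ∈ LinearMap.ker (LinearMap.mulLeft R (x ^ l)) := by
      change LinearMap.ker (LinearMap.mulLeft R (x ^ l)) = _ at h1
      rw [h1]; exact h2
    exact h3
  obtain ⟨c, hc⟩ := Ideal.exists_pow_inf_eq_pow_smul a (Ideal.span {x ^ (l + k)} : Ideal R)
  -- Artin-Rees
  have hAR : ∀ r : R, x ^ (l + k) * r ∈ a ^ (s + c) → x ^ l * r ∈ a ^ s := by
    intro r hr
    have h1 : x ^ (l + k) * r ∈ a ^ (s + c) • (⊤ : Ideal R) ⊓ Ideal.span {x ^ (l + k)} := by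
      refine ⟨by simpa using hr, Ideal.mem_span_singleton.2 (Dvd.intro _ rfl)⟩
    rw [hc _ (by omega), Nat.add_sub_cancel] at h1
    have h2 : x ^ (l + k) * r ∈ a ^ s * Ideal.span {x ^ (l + k)} :=
      Ideal.mul_mono_right inf_le_right h1
    obtain ⟨w, hw, hw'⟩ := Ideal.mem_mul_span_singleton.1 h2
    have h3 : x ^ l * (r - w) = 0 := by
      apply hl
      rw [mul_sub, ← hw', mul_comm w, sub_self]
    have h4 : x ^ l * r = x ^ l * w := by
      rw [mul_sub] at h3
      exact sub_eq_zero.1 h3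
    rw [h4]
    exact Ideal.mul_mem_left _ _ hw
  -- the ideal `J = a^(s+c) + x^(l+k)`
  let I : Ideal R := a ^ (s + c)
  let J : Ideal R := I ⊔ Ideal.span {x ^ (l + k)}
  have hIJ : I ≤ J := le_sup_left
  have hle : t ≤ s + c := by omega
  have hsc : s ≤ s + c := by omega
  let K := LinearMap.ker (tr hIJ)
  have hKz : pull K.subtype (pull (tr (pow_le (a := a) hsc)) z') = 0 := by
    have hm : ∀ v : K, ∃ r : R, Submodule.Quotient.mk (x ^ (l + k) * r) = (v : R ⧸ I) := by
      rintro ⟨v, hv⟩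
      obtain ⟨v, rfl⟩ := Submodule.mkQ_surjective _ v
      have : v ∈ J := by
        rw [LinearMap.mem_ker] at hv
        exact (Submodule.Quotient.mk_eq_zero _).1 hv
      obtain ⟨p, hp, q, hq, rfl⟩ := Submodule.mem_sup.1 this
      obtain ⟨r, rfl⟩ := Ideal.mem_span_singleton'.1 hq
      refine ⟨r, ?_⟩
      change _ = Submodule.Quotient.mk _
      rw [Submodule.Quotient.eq]
      convert I.neg_mem hp using 1
      ring
    choose ρ hρ using hm
    have huniq : ∀ r r' : R, (Submodule.Quotient.mk (x ^ (l + k) * r) : R ⧸ I) =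
        Submodule.Quotient.mk (x ^ (l + k) * r') →
        (Submodule.Quotient.mk (x ^ l * r) : R ⧸ a ^ s) = Submodule.Quotient.mk (x ^ l * r') := by
      intro r r' h
      rw [Submodule.Quotient.eq, ← mul_sub] at h ⊢
      exact hAR _ h
    let θ : K →ₗ[R] R ⧸ a ^ s :=
      { toFun := fun v => Submodule.Quotient.mk (x ^ l * ρ v)
        map_add' := by
          intro v w
          rw [← Submodule.Quotient.mk_add, ← mul_add]
          apply huniq
          rw [hρ, mul_add, Submodule.Quotient.mk_add, hρ, hρ]
          rfl
        map_smul' := by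
          intro r v
          rw [RingHom.id_apply, ← Submodule.Quotient.mk_smul, smul_eq_mul, mul_left_comm]
          apply huniq
          rw [hρ, mul_left_comm, ← smul_eq_mul, Submodule.Quotient.mk_smul, hρ]
          rfl }
    have hfac : (tr (pow_le (a := a) hsc)) ∘ₗ K.subtype = x ^ k • θ := by
      ext v
      change tr (pow_le (a := a) hsc) (v : R ⧸ I) = x ^ k • (Submodule.Quotient.mk (x ^ l * ρ v) : R ⧸ a ^ s)
      rw [← hρ v, ← Submodule.Quotient.mk_smul, smul_eq_mul, ← mul_assoc, ← pow_add, add_comm k l]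
      rfl
    rw [← pull_comp, hfac, smul_pull, ← pull_smul, hk, pull_zero]
  have hsurj : Function.Surjective (tr hIJ) := by
    intro v
    obtain ⟨v, rfl⟩ := Submodule.mkQ_surjective _ v
    exact ⟨Submodule.Quotient.mk v, rfl⟩
  obtain ⟨y, hy⟩ := exists_pull_eq K.subtype (tr hIJ) (LinearMap.exact_subtype_ker_map _)
    (Submodule.subtype_injective _) hsurj _ hKz
  have hbJ : (a ⊔ Ideal.span {x}) ^ (s + c + (l + k)) ≤ J := by
    refine (Ideal.sup_pow_add_le_pow_sup_pow).trans ?_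
    rw [Ideal.span_singleton_pow]
  refine ⟨s + c + (l + k), by omega, pull (tr hbJ) y, ?_⟩
  rw [hz', ← pull_comp, tr_comp] at hy
  have h5 := congrArg (pull (tr (pow_le (a := a) (by omega : s + c ≤ s + c + (l + k))))) hy
  rw [← pull_comp, ← pull_comp, tr_comp, tr_comp] at h5
  rw [← pull_comp, tr_comp]
  exact h5

lemma surj_ext [IsNoetherianRing R] (a b : Ideal R) (hab : a ≤ b) (i : ℕ) (M : Type u)
    [AddCommGroup M] [Module R M]
    (hv : ∀ c : Ideal R, ∀ x ∈ b, Van c x i M) (t : ℕ) (z : E R (R ⧸ a ^ t) M i) :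
    ∃ s, ∃ h : t ≤ s, ∃ y : E R (R ⧸ b ^ s) M i,
      pull (tr (Ideal.pow_right_mono hab s)) y = pull (tr (pow_le (a := a) h)) z := by
  let P : Set (Ideal R) := {c | c ≤ b ∧ ∃ hac : a ≤ c, 
    ∃ s, ∃ h : t ≤ s, ∃ y : E R (R ⧸ c ^ s) M i,
      pull (tr (Ideal.pow_right_mono hac s)) y = pull (tr (pow_le (a := a) h)) z}
  have hP : P.Nonempty := ⟨a, hab, le_rfl, t, le_rfl, z, rfl⟩
  obtain ⟨c, ⟨hcb, hac, s, hs, y, hy⟩, hmax⟩ := set_has_maximal_iff_noetherian.2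
    (inferInstance : IsNoetherian R R) P hP
  have hcb' : c = b := by
    by_contra hne
    obtain ⟨x, hxb, hxc⟩ := SetLike.exists_of_lt (lt_of_le_of_ne hcb hne)
    refine hmax (c ⊔ Ideal.span {x}) ?_ (lt_of_le_of_ne le_sup_left ?_)
    · refine ⟨sup_le hcb ((Ideal.span_singleton_le_iff_mem _).2 hxb), hac.trans le_sup_left, ?_⟩
      obtain ⟨s', hs', y', hy'⟩ := step c x i M (hv c x hxb) s y
      refine ⟨s', hs.trans hs', y', ?_⟩
      have h1 := congrArg (pull (tr (Ideal.pow_right_mono hac s'))) hy'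
      rw [← pull_comp, ← pull_comp, tr_comp, tr_comp] at h1
      rw [h1]
      have h2 := congrArg (pull (tr (pow_le (a := a) hs'))) hy
      rw [← pull_comp, ← pull_comp, tr_comp, tr_comp] at h2
      exact h2
    · intro h
      apply hxc
      rw [h]
      exact Ideal.mem_sup_right (Ideal.mem_span_singleton_self x)
  subst hcb'
  exact ⟨s, hs, y, hy⟩

lemma dm_of_mdim [IsLocalRing R] (M : Type u) [AddCommGroup M] [Module R M]
    (n : ℕ) (hdim : mdim R M = (n : ℕ∞)) (x : R) (hx : x ∈ IsLocalRing.maximalIdeal R) :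
    Dm x n M := by
  intro l hl hxl
  have hlt : l.last < IsLocalRing.closedPoint R := by
    refine lt_of_le_of_ne (IsLocalRing.le_maximalIdeal l.last.2.ne_top) ?_
    intro h
    rw [h] at hxl
    exact hxl hx
  let l' := l.snoc _ hlt
  have hl' : ∀ j, l' j ∈ Module.support R M := by
    intro j
    refine Module.mem_support_mono ?_ hl
    have : l'.head = l.head := by simp [l']
    rw [← this]
    exact LTSeries.monotone l' (Fin.zero_le j)
  let l'' : LTSeries (Module.support R M) :=
    { length := l'.length
      toFun := fun j => ⟨l' j, hl' j⟩
      step := fun j => l'.step j }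
  have h := Order.LTSeries.length_le_krullDim l''
  change _ ≤ mdim R M at h
  rw [hdim] at h
  have h2 : l''.length = l.length + 1 := by simp [l'', l']
  rw [h2] at h
  have h3 : l.length + 1 ≤ n := by exact_mod_cast h
  omega

theorem surj_main [IsNoetherianRing R] [IsLocalRing R] (a b : Ideal R) (hb : b ≠ ⊤) (hab : a ≤ b)
    (M : Type u) [AddCommGroup M] [Module R M] [Module.Finite R M]
    (n : ℕ) (hdim : mdim R M = (n : ℕ∞)) (t : ℕ) (z : E R (R ⧸ a ^ t) M n) :
    ∃ s, ∃ h : t ≤ s, ∃ y : E R (R ⧸ b ^ s) M n,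
      pull (tr (Ideal.pow_right_mono hab s)) y = pull (tr (pow_le (a := a) h)) z :=
  surj_ext a b hab n M (fun c x hx => van_main c x n M
    (dm_of_mdim M n hdim x (IsLocalRing.le_maximalIdeal hb hx)) n le_rfl) t z


section old

open Opposite Limits

/-- the complex computing the Ext modules. -/
abbrev KK {X : ModuleCat.{u} R} (P : ProjectiveResolution X) (Y : ModuleCat.{u} R) :
    ChainComplex (ModuleCat.{u} R)ᵒᵖ ℕ :=
  ((((linearYoneda R (ModuleCat.{u} R)).obj Y).rightOp).mapHomologicalComplex _).obj P.complex

/-- The old Ext modules. -/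
abbrev OE (X Y : ModuleCat.{u} R) (n : ℕ) : ModuleCat.{u} R :=
  ((_root_.Ext R (ModuleCat.{u} R) n).obj (op X)).obj Y

/-- Comparison isomorphism, on elements. -/
def oeMap {X : ModuleCat.{u} R} (P : ProjectiveResolution X) (Y : ModuleCat.{u} R) (n : ℕ) :
    OE X Y n ⟶ ((KK P Y).homology n).unop :=
  (P.isoLeftDerivedObj ((linearYoneda R (ModuleCat.{u} R)).obj Y).rightOp n).inv.unop

instance {X : ModuleCat.{u} R} (P : ProjectiveResolution X) (Y : ModuleCat.{u} R) (n : ℕ) :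
    IsIso (oeMap P Y n) := by
  exact (inferInstance : IsIso (P.isoLeftDerivedObj
    ((linearYoneda R (ModuleCat.{u} R)).obj Y).rightOp n).unop.symm.hom)

/-- `f` represents `w`. -/
def Rep {X : ModuleCat.{u} R} (P : ProjectiveResolution X) (Y : ModuleCat.{u} R) (n : ℕ)
    (f : P.complex.X n ⟶ Y) (w : OE X Y n) : Prop :=
  ∃ c : ((KK P Y).opcycles n).unop, ((KK P Y).pOpcycles n).unop.hom c = f ∧
    ((KK P Y).homologyι n).unop.hom c = (oeMap P Y n).hom w

variable {X X' : ModuleCat.{u} R} (P : ProjectiveResolution X) (P' : ProjectiveResolution X')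
  (Y : ModuleCat.{u} R) (n : ℕ)

lemma rep_exists (w : OE X Y n) : ∃ f, P.complex.d (n + 1) n ≫ f = 0 ∧ Rep P Y n f w := by
  have : Epi ((KK P Y).homologyι n).unop := inferInstance
  rw [ModuleCat.epi_iff_surjective] at this
  obtain ⟨c, hc⟩ := this ((oeMap P Y n).hom w)
  refine ⟨_, ?_, c, rfl, hc⟩
  have h := congr_arg Quiver.Hom.unop ((KK P Y).d_pOpcycles (n + 1) n)
  rw [unop_comp, unop_zero] at h
  exact congr_arg (fun k => k.hom c) h

lemma rep_of (f : P.complex.X n ⟶ Y) (hf : P.complex.d (n + 1) n ≫ f = 0) :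
    ∃ w, Rep P Y n f w := by
  let k : (KK P Y).X n ⟶ op (ModuleCat.of R R) :=
    (ModuleCat.ofHom (LinearMap.toSpanSingleton R (P.complex.X n ⟶ Y) f)).op
  have hk : (KK P Y).d (n + 1) n ≫ k = 0 := by
    apply Quiver.Hom.unop_inj
    apply ModuleCat.hom_ext
    apply LinearMap.ext_ring
    change P.complex.d (n + 1) n ≫ ((1 : R) • f) = 0
    rw [one_smul, hf]
  let c := ((KK P Y).descOpcycles k (n + 1) (by simp) hk).unop.hom (1 : R)
  have hs : Function.Surjective (oeMap P Y n) := by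
    rw [← ModuleCat.epi_iff_surjective]; infer_instance
  obtain ⟨w, hw⟩ := hs (((KK P Y).homologyι n).unop.hom c)
  refine ⟨w, c, ?_, hw.symm⟩
  have h := congr_arg Quiver.Hom.unop ((KK P Y).p_descOpcycles k (n + 1) (by simp) hk)
  rw [unop_comp] at h
  refine (congr_arg (fun k => k.hom (1 : R)) h).trans ?_
  change (1 : R) • f = f
  rw [one_smul]

lemma rep_map {g : X' ⟶ X} (φ : ProjectiveResolution.Hom P' P g) (f : P.complex.X n ⟶ Y)
    (w : OE X Y n) (h : Rep P Y n f w) :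
    Rep P' Y n (φ.hom.f n ≫ f) (((_root_.Ext R (ModuleCat.{u} R) n).map g.op).app Y w) := by
  obtain ⟨c, rfl, hc⟩ := h
  let F := ((linearYoneda R (ModuleCat.{u} R)).obj Y).rightOp
  let ψ : KK P' Y ⟶ KK P Y := (F.mapHomologicalComplex _).map φ.hom
  refine ⟨(HomologicalComplex.opcyclesMap ψ n).unop.hom c, ?_, ?_⟩
  · have h := congr_arg Quiver.Hom.unop (HomologicalComplex.p_opcyclesMap ψ n)
    rw [unop_comp, unop_comp] at h
    exact congr_arg (fun k => k.hom c) h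
  · have h := congr_arg Quiver.Hom.unop (HomologicalComplex.homologyι_naturality ψ n)
    rw [unop_comp, unop_comp] at h
    have h1 := congr_arg (fun k => k.hom c) h
    have h2 := congr_arg Quiver.Hom.unop (ProjectiveResolution.isoLeftDerivedObj_inv_naturality g
      P' P φ.hom (by simpa using φ.hom_f_zero_comp_π_f_zero) F n)
    rw [unop_comp, unop_comp] at h2
    have h3 := congr_arg (fun k => k.hom w) h2
    refine h1.symm.trans (Eq.trans ?_ h3.symm)
    exact congr_arg (HomologicalComplex.homologyMap ψ n).unop.hom hc

lemma rep_sub (f f' : P.complex.X n ⟶ Y) (w w' : OE X Y n) (h : Rep P Y n f w)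
    (h' : Rep P Y n f' w') : Rep P Y n (f - f') (w - w') := by
  obtain ⟨c, rfl, hc⟩ := h
  obtain ⟨c', rfl, hc'⟩ := h'
  refine ⟨c - c', map_sub _ _ _, ?_⟩
  rw [map_sub, map_sub, hc, hc']

lemma rep_inj (c c' : ((KK P Y).opcycles n).unop)
    (h : ((KK P Y).pOpcycles n).unop.hom c = ((KK P Y).pOpcycles n).unop.hom c') : c = c' := by
  have : Mono ((KK P Y).pOpcycles n).unop := inferInstance
  rw [ModuleCat.mono_iff_injective] at this
  exact this h

lemma oe_inj (w : OE X Y n) (h : (oeMap P Y n).hom w = 0) : w = 0 := by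
  have : Function.Injective (oeMap P Y n) := by
    rw [← ModuleCat.mono_iff_injective]; infer_instance
  exact this (h.trans (map_zero _).symm)

lemma rep_zero (w : OE X Y n) (h : Rep P Y n 0 w) : w = 0 := by
  obtain ⟨c, hc, hc'⟩ := h
  have : c = 0 := rep_inj P Y n c 0 (hc.trans (map_zero _).symm)
  apply oe_inj P
  rw [← hc', this, map_zero]

lemma rep_bdry (p : ℕ) (g : P.complex.X p ⟶ Y) (w : OE X Y n)
    (h : Rep P Y n (P.complex.d n p ≫ g) w) : w = 0 := by
  obtain ⟨c, hc, hc'⟩ := h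
  have h := congr_arg Quiver.Hom.unop ((KK P Y).p_fromOpcycles n p)
  rw [unop_comp] at h
  have h1 := congr_arg (fun k => k.hom g) h
  have : c = ((KK P Y).fromOpcycles n p).unop.hom g := rep_inj P Y n _ _ (hc.trans h1.symm)
  have h := congr_arg Quiver.Hom.unop ((KK P Y).homologyι_comp_fromOpcycles n p)
  rw [unop_comp, unop_zero] at h
  apply oe_inj P
  rw [← hc', this]
  exact congr_arg (fun k => k.hom g) h

lemma extMk_zero_inj (f : P.complex.X 0 ⟶ Y) (hf : P.complex.d 1 0 ≫ f = 0)
    (h : P.extMk f 1 rfl hf = (0 : Ext.{u} X Y 0)) : f = 0 := by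
  simp only [← P.extEquivCohomologyClass.apply_eq_iff_eq,
    ProjectiveResolution.extEquivCohomologyClass_extMk,
    ProjectiveResolution.extEquivCohomologyClass_zero,
    CochainComplex.HomComplex.CohomologyClass.mk_eq_zero_iff] at h
  rw [CochainComplex.HomComplex.Cocycle.toSingleMk_mem_coboundaries_iff _ _ _ _ _ 1
    (by simp)] at h
  obtain ⟨g, hg⟩ := h
  have hz : IsZero (P.cochainComplex.X 1) :=
    CochainComplex.isZero_of_isStrictlyLE _ 0 1 (by simp)
  rw [hz.eq_of_src g 0, comp_zero] at hg
  rw [← cancel_epi (P.cochainComplexXIso (-(0 : ℕ)) 0 rfl).hom, comp_zero]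
  exact hg.symm

/-- comparison of equalities in the two models. -/
lemma rep_eq (f f' : P.complex.X n ⟶ Y) (w w' : OE X Y n) (h : Rep P Y n f w)
    (h' : Rep P Y n f' w') (hf : P.complex.d (n + 1) n ≫ f = 0)
    (hf' : P.complex.d (n + 1) n ≫ f' = 0)
    (he : P.extMk f (n + 1) rfl hf = (P.extMk f' (n + 1) rfl hf' : Ext.{u} X Y n)) : w = w' := by
  rw [← sub_eq_zero] at he ⊢
  rw [ProjectiveResolution.sub_extMk] at he
  have hs := rep_sub P Y n f f' w w' h h'
  cases n with
  | zero =>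
    have := extMk_zero_inj P Y _ _ he
    rw [this] at hs
    exact rep_zero P Y _ _ hs
  | succ n =>
    rw [ProjectiveResolution.extMk_eq_zero_iff _ _ _ _ _ n rfl] at he
    obtain ⟨g, hg⟩ := he
    rw [← hg] at hs
    exact rep_bdry P Y _ _ g _ hs

/-- the map on old Ext modules. -/
def opull (g : X' ⟶ X) : OE X Y n ⟶ OE X' Y n :=
  ((_root_.Ext R (ModuleCat.{u} R) n).map g.op).app Y

theorem surj_old [IsNoetherianRing R] [IsLocalRing R] (a b : Ideal R) (hb : b ≠ ⊤) (hab : a ≤ b)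
    (M : Type u) [AddCommGroup M] [Module R M] [Module.Finite R M] (n : ℕ)
    (hdim : mdim R M = (n : ℕ∞)) (t : ℕ)
    (z : OE (ModuleCat.of R (R ⧸ a ^ t)) (ModuleCat.of R M) n) :
    ∃ s, ∃ h : t ≤ s, ∃ y : OE (ModuleCat.of R (R ⧸ b ^ s)) (ModuleCat.of R M) n,
      opull _ _ (ModuleCat.ofHom (tr (Ideal.pow_right_mono hab s))) y =
        opull _ _ (ModuleCat.ofHom (tr (pow_le (a := a) h))) z := by
  let P (I : Ideal R) := projectiveResolution (ModuleCat.of R (R ⧸ I))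
  obtain ⟨f, hf, hz⟩ := rep_exists (P (a ^ t)) _ _ z
  obtain ⟨s, h, y, hy⟩ := surj_main a b hb hab M n hdim t ((P (a ^ t)).extMk f (n + 1) rfl hf)
  obtain ⟨f', hf', rfl⟩ := (P (b ^ s)).extMk_surjective y (n + 1) rfl
  obtain ⟨w, hw⟩ := rep_of _ _ _ f' hf'
  refine ⟨s, h, w, ?_⟩
  let φ : ProjectiveResolution.Hom (P (a ^ s)) (P (b ^ s))
    (ModuleCat.ofHom (tr (Ideal.pow_right_mono hab s))) :=
    ⟨ProjectiveResolution.lift (ModuleCat.ofHom (tr (Ideal.pow_right_mono hab s))) _ _, by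
      simpa using ProjectiveResolution.lift_commutes_zero _ _ _⟩
  let ψ : ProjectiveResolution.Hom (P (a ^ s)) (P (a ^ t))
    (ModuleCat.ofHom (tr (pow_le (a := a) h))) :=
    ⟨ProjectiveResolution.lift (ModuleCat.ofHom (tr (pow_le (a := a) h))) _ _, by
      simpa using ProjectiveResolution.lift_commutes_zero _ _ _⟩
  have h1 := rep_map _ _ _ _ φ _ _ hw
  have h2 := rep_map _ _ _ _ ψ _ _ hz
  simp only [pull] at hy
  rw [ProjectiveResolution.mk₀_comp_extMk _ _ _ _ φ,
    ProjectiveResolution.mk₀_comp_extMk _ _ _ _ ψ] at hy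
  exact rep_eq _ _ _ _ _ _ _ h1 h2 _ _ hy

end old

section final

open Opposite Limits localCohomology

/-- natural map between diagrams. -/
def natMap {a b : Ideal R} (hab : a ≤ b) :
    ringModIdeals (idealPowersDiagram a) ⟶ ringModIdeals (idealPowersDiagram b) where
  app t := ModuleCat.ofHom (tr (Ideal.pow_right_mono hab t.unop))
  naturality s t f := by
    apply ModuleCat.hom_ext
    apply Submodule.linearMap_qext
    apply LinearMap.ext_ring
    rfl

/-- natural map between Ext diagrams. -/
def diagMap {a b : Ideal R} (hab : a ≤ b) (n : ℕ) :
    diagram (idealPowersDiagram b) n ⟶ diagram (idealPowersDiagram a) n :=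
  Functor.whiskerRight (NatTrans.op (natMap hab)) (_root_.Ext R (ModuleCat.{u} R) n)

instance (a : Ideal R) (n : ℕ) : HasColimit (diagram (idealPowersDiagram a) n) :=
  hasColimitDiagram.{u, 0} _ _

/-- natural map between local cohomology modules. -/
def lcMap {a b : Ideal R} (hab : a ≤ b) (n : ℕ) : localCohomology b n ⟶ localCohomology a n :=
  colimMap (diagMap hab n)

theorem lcMap_surj [IsNoetherianRing R] [IsLocalRing R] (a b : Ideal R) (hb : b ≠ ⊤) (hab : a ≤ b)
    (M : Type u) [AddCommGroup M] [Module R M] [Module.Finite R M] (n : ℕ)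
    (hdim : mdim R M = (n : ℕ∞)) :
    Function.Surjective ((lcMap hab n).app (ModuleCat.of R M)) := by
  rw [← ModuleCat.epi_iff_surjective]
  constructor
  intro Z u v huv
  have hc := isColimitOfPreserves ((evaluation _ _).obj (ModuleCat.of R M))
    (colimit.isColimit (diagram (idealPowersDiagram a) n))
  apply hc.hom_ext
  intro j
  apply ModuleCat.hom_ext
  apply LinearMap.ext
  intro z
  obtain ⟨s, h, y, hy⟩ := surj_old a b hb hab M n hdim j.unop.unop z
  let φ : j ⟶ op (op s) := (homOfLE h).op.op
  have e1 : ∀ (y : ((diagram (idealPowersDiagram b) n).obj (op (op s))).obj (ModuleCat.of R M)),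
      (colimit.ι (diagram (idealPowersDiagram a) n) (op (op s))).app (ModuleCat.of R M)
        (((diagMap hab n).app (op (op s))).app (ModuleCat.of R M) y) =
      (lcMap hab n).app (ModuleCat.of R M)
        ((colimit.ι (diagram (idealPowersDiagram b) n) (op (op s))).app (ModuleCat.of R M) y) := by
    intro y
    have := congr_arg (fun k => k.app (ModuleCat.of R M) y)
      (ι_colimMap (diagMap hab n) (op (op s)))
    exact this.symm
  have e2 : (colimit.ι (diagram (idealPowersDiagram a) n) j).app (ModuleCat.of R M) z =
      (colimit.ι (diagram (idealPowersDiagram a) n) (op (op s))).app (ModuleCat.of R M)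
        (((diagram (idealPowersDiagram a) n).map φ).app (ModuleCat.of R M) z) := by
    have := congr_arg (fun k => k.app (ModuleCat.of R M) z)
      (colimit.w (diagram (idealPowersDiagram a) n) φ)
    exact this.symm
  have e3 : ((diagMap hab n).app (op (op s))).app (ModuleCat.of R M) y =
      ((diagram (idealPowersDiagram a) n).map φ).app (ModuleCat.of R M) z := hy
  rw [← e3, e1 y] at e2
  change u.hom ((colimit.ι (diagram (idealPowersDiagram a) n) j).app (ModuleCat.of R M) z) =
    v.hom ((colimit.ι (diagram (idealPowersDiagram a) n) j).app (ModuleCat.of R M) z)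
  rw [e2]
  exact congr_arg (fun k => k.hom ((colimit.ι (diagram (idealPowersDiagram b) n) (op (op s))).app
    (ModuleCat.of R M) y)) huv

lemma att_sub {T S : Type u} [AddCommGroup T] [Module R T] [AddCommGroup S] [Module R S]
    (g : T →ₗ[R] S) (hg : Function.Surjective g) : Att R S ⊆ Att R T := by
  rintro p ⟨hp, U, rfl⟩
  refine ⟨hp, LinearMap.ker (U.mkQ ∘ₗ g), ?_⟩
  exact ((LinearMap.quotKerEquivOfSurjective (U.mkQ ∘ₗ g)
    ((Submodule.mkQ_surjective U).comp hg)).annihilator_eq).symm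

end final

end Stmt6Aux

theorem stmt6 (R : Type u) [CommRing R] [IsNoetherianRing R] [IsLocalRing R]
    (a b : Ideal R) (ha : a ≠ ⊤) (hb : b ≠ ⊤) (hab : a ≤ b)
    (M : Type u) [AddCommGroup M] [Module R M] [Module.Finite R M]
    (n : ℕ) (hdim : mdim R M = (n : ℕ∞)) :
    Att R (LC a n M) ⊆ Att R (LC b n M) ∧
      (Nontrivial (LC a n M) → Nontrivial (LC b n M)) := by
  have hs := Stmt6Aux.lcMap_surj a b hb hab M n hdim
  refine ⟨Stmt6Aux.att_sub ((Stmt6Aux.lcMap hab n).app (ModuleCat.of R M)).hom hs, fun h => ?_⟩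
  exact hs.nontrivial

end
end
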